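/- arXiv:math/0209184 — 3 statements merged into one kernel-verified Lean document; each statement's English description precedes it below -/
import Mathlib

section
/- Let R be a polynomial ring over a field, let M be a torsionfree graded R-module of rank e that is minimally generated by n homogeneous elements all of the same degree, and set r = n − e. Then for every submodule U of M generated by t < n elements, ht(U :_R M) ≤ (t + 1)·r, where U :_R M = {x ∈ R : xM ⊆ U}. -/
open IsLocalRing

noncomputable section

/-- The ideal of `i × i` minors of a matrix. -/
def Matrix.minorsIdeal {R : Type*} [CommRing R] {n m : ℕ}
    (φ : Matrix (Fin n) (Fin m) R) (i : ℕ) : Ideal R :=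
  Ideal.span { d | ∃ (f : Fin i → Fin n) (g : Fin i → Fin m), d = (φ.submatrix f g).det }

/-- The height of an ideal: the minimal height of a prime ideal containing it
(`⊤`, i.e. `+∞`, if there is no such prime). -/
def Ideal.ht {R : Type*} [CommRing R] (I : Ideal R) : ℕ∞ :=
  ⨅ (P : PrimeSpectrum R) (_ : I ≤ P.asIdeal), Order.height P

/-- The minimal number of generators of a module. -/
def Module.mu (R M : Type*) [Semiring R] [AddCommMonoid M] [Module R M] : ℕ :=
  sInf {n | ∃ v : Fin n → M, Submodule.span R (Set.range v) = ⊤}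

/-- A local ring is regular if it is Noetherian and its maximal ideal can be generated by
`dim R` elements. -/
def IsRegularLocal (R : Type*) [CommRing R] [IsLocalRing R] : Prop :=
  IsNoetherianRing R ∧
    (Module.mu R (maximalIdeal R) : ℕ∞) = Order.height (closedPoint R)

universe u

theorem MvPolynomial.height_eq_of_isMaximal {F : Type*} [Field F] {s : ℕ}
    (P : Ideal (MvPolynomial (Fin s) F)) [hP : P.IsMaximal] : P.height = s := by
  induction s with
  | zero =>
    have h := Ideal.height_le_ringKrullDim_of_ne_top hP.ne_top
    rw [MvPolynomial.ringKrullDim_of_isNoetherianRing, ringKrullDim_eq_zero_of_field] at h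
    simpa using h
  | succ s ih =>
    let e := (MvPolynomial.finSuccEquiv F s).toRingEquiv
    let Q : Ideal (Polynomial (MvPolynomial (Fin s) F)) := P.map e
    have hQ : Q.IsMaximal := Ideal.map_isMaximal_of_equiv e
    have hp : (Q.comap Polynomial.C).IsMaximal := Polynomial.isMaximal_comap_C_of_isJacobsonRing Q
    have : Q.LiesOver (Q.comap Polynomial.C) := ⟨rfl⟩
    have h := Polynomial.height_eq_height_add_one (Q.comap Polynomial.C) Q
    rw [ih, RingEquiv.height_map e P] at h
    simpa using h

/-- The height of a maximal ideal of an affine domain is at least the transcendence degree, which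
is finite. -/
theorem Ideal.trdeg_le_height_of_isMaximal (F : Type*) [Field F] {A : Type*} [CommRing A]
    [IsDomain A] [Algebra F A] [Algebra.FiniteType F A] (P : Ideal A) [P.IsMaximal] :
    ∃ s : ℕ, Algebra.trdeg F A = s ∧ s ≤ P.height := by
  obtain ⟨s, g, hg, hint⟩ := exists_integral_inj_algHom_of_fg F A
  refine ⟨s, ?_, ?_⟩
  · have hx : AlgebraicIndependent F (fun i => g (MvPolynomial.X i)) := by
      have : MvPolynomial.aeval (fun i => g (MvPolynomial.X i)) = g := by ext; simp
      rw [algebraicIndependent_iff_injective_aeval, this]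
      exact hg
    have htop : Algebra.IsIntegral
        (Algebra.adjoin F (Set.range fun i => g (MvPolynomial.X i))) A := by
      constructor
      intro x
      obtain ⟨p, hp, hpx⟩ := hint x
      have hmem (y) : g y ∈ Algebra.adjoin F (Set.range fun i => g (MvPolynomial.X i)) := by
        induction y using MvPolynomial.induction_on with
        | C a =>
          rw [← MvPolynomial.algebraMap_eq, g.commutes]
          exact Subalgebra.algebraMap_mem _ _
        | add p q hp hq => rw [map_add]; exact add_mem hp hq
        | mul_X p i hp =>
          rw [map_mul]
          exact mul_mem hp (Algebra.subset_adjoin ⟨i, rfl⟩)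
      let g' := g.codRestrict _ hmem
      refine ⟨p.map (g' : _ →+* _), hp.map _, ?_⟩
      rw [Polynomial.eval₂_map]
      exact hpx
    have := (hx.isTranscendenceBasis_iff_isAlgebraic).2 inferInstance
    simpa using this.lift_cardinalMk_eq_trdeg.symm
  · algebraize [g.toRingHom]
    have : FaithfulSMul (MvPolynomial (Fin s) F) A :=
      (faithfulSMul_iff_algebraMap_injective _ _).2 hg
    have : Algebra.IsIntegral (MvPolynomial (Fin s) F) A := ⟨hint⟩
    have : (P.under (MvPolynomial (Fin s) F)).IsMaximal :=
      Ideal.isMaximal_comap_of_isIntegral_of_isMaximal P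
    have h1 := MvPolynomial.height_eq_of_isMaximal (P.under (MvPolynomial (Fin s) F))
    have : IsNoetherianRing A := Algebra.FiniteType.isNoetherianRing F A
    rw [Ideal.height_eq_height_add_of_liesOver_of_hasGoingDown
      (P.under (MvPolynomial (Fin s) F)) P, h1]
    exact le_self_add

theorem MvPolynomial.height_comap_map_le {k F : Type*} [Field k] [Field F] [Algebra k F] {q : ℕ}
    (p : Ideal (MvPolynomial (Fin q) F)) [p.IsPrime] :
    (p.comap (MvPolynomial.map (algebraMap k F))).height ≤ p.height := by
  let := MvPolynomial.algebraMvPolynomial (R := k) (S := F) (σ := Fin q)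
  have : Module.Flat (MvPolynomial (Fin q) k) (MvPolynomial (Fin q) F) :=
    Module.Flat.isBaseChange k _ F _ (Algebra.IsPushout.out (S := MvPolynomial (Fin q) k) (R' := F))
  have : p.LiesOver (p.comap (MvPolynomial.map (algebraMap k F))) := ⟨rfl⟩
  rw [Ideal.height_eq_height_add_of_liesOver_of_hasGoingDown
    (p.comap (MvPolynomial.map (algebraMap k F))) p]
  exact le_self_add

/-- A prime of large height containing a small set `s` yields a prime of small height in any
polynomial ring surjecting onto the quotient by `s`. -/
theorem MvPolynomial.exists_prime_height_le_of_surjective {F : Type*} [Field F] {q : ℕ} {A : Type*}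
    [CommRing A] [IsNoetherianRing A] (P : Ideal A) [P.IsPrime] (s : Set A) (hs : s ⊆ P)
    {c D : ℕ} (hc : s.encard ≤ c) (hD : D ≤ P.height)
    (π : MvPolynomial (Fin q) F →+* A ⧸ Ideal.span s) (hπ : Function.Surjective π) :
    ∃ p : Ideal (MvPolynomial (Fin q) F), p.IsPrime ∧ RingHom.ker π ≤ p ∧
      p.height + D ≤ q + c := by
  have hle : Ideal.span s ≤ P := Ideal.span_le.2 hs
  let P' := P.map (Ideal.Quotient.mk (Ideal.span s))
  have : P'.IsPrime := Ideal.isPrime_map_quotientMk_of_isPrime hle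
  have h := Ideal.height_le_height_add_encard_of_subset s hs
  obtain ⟨l, hl, hlen⟩ := P'.exists_ltSeries_length_eq_height
  let l' := l.map (PrimeSpectrum.comap π) (RingHom.strictMono_comap_of_surjective hπ)
  refine ⟨l'.head.asIdeal, inferInstance, ?_, ?_⟩
  · simp only [LTSeries.head_map, l', PrimeSpectrum.comap_asIdeal]
    exact Ideal.comap_mono bot_le
  · obtain ⟨m, hm, hmlen⟩ := l'.head.asIdeal.exists_ltSeries_length_eq_height
    have h1 : m.last = l'.head := hm
    have h2 := Order.LTSeries.length_le_krullDim (m.smash l' h1)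
    have h3 := MvPolynomial.ringKrullDim_of_isNoetherianRing (R := F) (ι := Fin q)
    rw [ringKrullDim_eq_zero_of_field, ringKrullDim] at h3
    rw [h3] at h2
    have h4 : m.length + l.length ≤ q := by
      have : ((m.length + l.length : ℕ) : WithBot ℕ∞) ≤ (q : ℕ) := by
        simpa [l'] using h2
      exact_mod_cast this
    have h5 : (D : ℕ∞) ≤ l.length + c := by
      rw [hlen]
      exact hD.trans (h.trans (by gcongr))
    rw [← hmlen]
    norm_cast at h5 ⊢
    omega

theorem Matrix.exists_ne_zero_mulVec_eq_zero {D : Type*} [CommRing D] [Nontrivial D]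
    {σ ν : Type*} [Fintype σ] [Fintype ν] (A : Matrix σ ν D) (h : Fintype.card σ < Fintype.card ν) :
    ∃ u : ν → D, u ≠ 0 ∧ A.mulVec u = 0 := by
  by_contra! H
  refine h.not_ge (card_le_of_injective D A.mulVecLin ?_)
  rw [← LinearMap.ker_eq_bot, LinearMap.ker_eq_bot']
  intro u hu
  by_contra h0
  exact H u h0 hu

theorem Matrix.exists_mul_eq_one_of_vecMul_injective {F : Type*} [Field F] {σ ν : Type*}
    [Fintype σ] [DecidableEq σ] [Fintype ν] [DecidableEq ν] (A : Matrix σ ν F)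
    (h : ∀ α, A.vecMul α = 0 → α = 0) : ∃ H : Matrix ν σ F, A * H = 1 := by
  obtain ⟨G, hG⟩ := LinearMap.exists_leftInverse_of_injective A.vecMulLinear
    (LinearMap.ker_eq_bot'.2 h)
  refine ⟨Matrix.of fun j => G (Pi.single j 1), ?_⟩
  ext i l
  have h1 := congrFun (LinearMap.congr_fun hG (Pi.single i 1)) l
  rw [LinearMap.comp_apply, Matrix.vecMulLinear_apply, Matrix.single_one_vecMul,
    LinearMap.pi_apply_eq_sum_univ] at h1
  have h2 (x : ν) : (fun j => if x = j then (1 : F) else 0) = Pi.single x 1 := by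
    ext j
    simp [Pi.single_apply, eq_comm]
  simpa [Matrix.mul_apply, Matrix.one_apply, Pi.single_apply, h2, eq_comm] using h1.symm

namespace MvPolynomial

variable {k : Type*} [Field k] {ι τ : Type*} [DecidableEq ι]

/-- A `k`-linearly independent family stays independent over polynomials in further variables. -/
theorem eq_zero_of_sum_mul_rename_eq_zero {n : ℕ} {h : Fin n → MvPolynomial τ k}
    (hh : LinearIndependent k h) (m : ι) (u : Fin n → MvPolynomial ({i : ι // i ≠ m} × τ) k)
    (hu : ∑ j, rename (Prod.map Subtype.val id) (u j) * rename (Prod.mk m) (h j) = 0) : u = 0 := by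
  let E : MvPolynomial (ι × τ) k →ₐ[k] MvPolynomial τ (MvPolynomial ({i : ι // i ≠ m} × τ) k) :=
    aeval fun x => if hx : x.1 = m then X x.2 else C (X (⟨x.1, hx⟩, x.2))
  have hE1 (p) : E (rename (Prod.mk m) p) = map C p := by
    induction p using MvPolynomial.induction_on with
    | C a => simp [E, MvPolynomial.algebraMap_apply]
    | add p q hp hq => simp [hp, hq]
    | mul_X p i hp => simp [hp, E]
  have hE2 (p) : E (rename (Prod.map Subtype.val id) p) = C p := by
    induction p using MvPolynomial.induction_on with
    | C a => simp [E, MvPolynomial.algebraMap_apply]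
    | add p q hp hq => simp [hp, hq]
    | mul_X p i hp => simp [hp, E, i.1.2]
  have h1 := congrArg E hu
  simp only [map_sum, map_mul, hE1, hE2, map_zero] at h1
  have h2 (d) (b) : ∑ j, coeff d (h j) * coeff b (u j) = 0 := by
    have := congrArg (fun p => coeff b (coeff d p)) h1
    simp only [coeff_sum, coeff_C_mul, coeff_map, coeff_zero] at this
    simpa only [mul_comm (u _), coeff_C_mul] using this
  rw [Fintype.linearIndependent_iff] at hh
  ext j b
  refine hh (fun j => coeff b (u j)) ?_ j
  ext d
  simpa [coeff_sum, mul_comm] using h2 d b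

/-- Generic copies of a linearly independent family of polynomials are the rows of a matrix of
full row rank. -/
theorem eq_zero_of_sum_mul_algebraMap_rename_eq_zero [Fintype ι] {n : ℕ} (hn : Fintype.card ι ≤ n)
    {h : Fin n → MvPolynomial τ k} (hh : LinearIndependent k h)
    {Ω : Type*} [Field Ω] [Algebra (MvPolynomial (ι × τ) k) Ω]
    [FaithfulSMul (MvPolynomial (ι × τ) k) Ω] (α : ι → Ω)
    (hα : ∀ j, ∑ i, α i * algebraMap (MvPolynomial (ι × τ) k) Ω (rename (Prod.mk i) (h j)) = 0) :
    α = 0 := by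
  ext m
  have hcard : Fintype.card {i : ι // i ≠ m} < Fintype.card (Fin n) := by
    rw [Fintype.card_fin]
    exact (Fintype.card_subtype_lt (x := m) (by simp)).trans_le hn
  obtain ⟨u, hu0, hu⟩ := Matrix.exists_ne_zero_mulVec_eq_zero
    (Matrix.of fun (i : {i : ι // i ≠ m}) j =>
      (rename (Prod.mk i) (h j) : MvPolynomial ({i : ι // i ≠ m} × τ) k)) hcard
  let ρ : MvPolynomial ({i : ι // i ≠ m} × τ) k →ₐ[k] MvPolynomial (ι × τ) k :=
    rename (Prod.map Subtype.val id)
  have hu' (i : ι) (hi : i ≠ m) : ∑ j, ρ (u j) * rename (Prod.mk i) (h j) = 0 := by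
    have := congrArg ρ (congrFun hu ⟨i, hi⟩)
    simp only [Matrix.mulVec, dotProduct, Matrix.of_apply, map_sum, map_mul, Pi.zero_apply,
      map_zero, ρ, rename_rename] at this
    rw [← this]
    refine Finset.sum_congr rfl fun j _ => ?_
    rw [mul_comm]
    rfl
  have h1 : ∑ i, α i * algebraMap (MvPolynomial (ι × τ) k) Ω
      (∑ j, ρ (u j) * rename (Prod.mk i) (h j)) = 0 := by
    simp only [map_sum, map_mul, Finset.mul_sum]
    rw [Finset.sum_comm]
    refine Finset.sum_eq_zero fun j _ => ?_
    rw [← mul_zero (algebraMap (MvPolynomial (ι × τ) k) Ω (ρ (u j))), ← hα j, Finset.mul_sum]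
    exact Finset.sum_congr rfl fun i _ => by ring
  rw [Finset.sum_eq_single m (fun i _ hi => by rw [hu' i hi, map_zero, mul_zero]) (by simp)] at h1
  refine (mul_eq_zero.1 h1).resolve_right fun h2 => hu0 ?_
  refine eq_zero_of_sum_mul_rename_eq_zero hh m u ?_
  exact FaithfulSMul.algebraMap_injective _ Ω (h2.trans (map_zero _).symm)

theorem IsHomogeneous.aeval_C_mul_X {σ : Type*} {Ω : Type*} [CommRing Ω] [Algebra k Ω]
    {p : MvPolynomial σ k} {d : ℕ} (hp : p.IsHomogeneous d) (z : σ → Ω) :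
    MvPolynomial.aeval (fun a => Polynomial.C (z a) * Polynomial.X) p =
      Polynomial.C (MvPolynomial.aeval z p) * Polynomial.X ^ d := by
  rw [MvPolynomial.aeval_def, MvPolynomial.aeval_def, eval₂_eq, eval₂_eq, map_sum, Finset.sum_mul]
  refine Finset.sum_congr rfl fun b hb => ?_
  have hd : ∑ i ∈ b.support, b i = d := by
    have := hp (mem_support_iff.1 hb)
    simpa [Finsupp.weight_apply, Finsupp.sum] using this
  simp only [mul_pow, Finset.prod_mul_distrib, Finset.prod_pow_eq_pow_sum, hd, map_mul, map_prod,
    map_pow, mul_assoc]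
  rfl

end MvPolynomial

open scoped IntermediateField.algebraAdjoinAdjoin in
theorem IntermediateField.trdeg_adjoin_range_le {k Ω : Type u} [Field k] [Field Ω] [Algebra k Ω]
    {σ : Type*} [Fintype σ] (y : σ → Ω) :
    Algebra.trdeg k (IntermediateField.adjoin k (Set.range y)) ≤ Fintype.card σ := by
  classical
  let S : Set Ω := Set.range y
  have h1 : Algebra.trdeg k (IntermediateField.adjoin k S) =
      Algebra.trdeg k (Algebra.adjoin k S) := by
    have := trdeg_add_eq k (Algebra.adjoin k S) (A := IntermediateField.adjoin k S)
    rw [← this, trdeg_eq_zero (R := Algebra.adjoin k S), add_zero]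
  rw [h1]
  let f : MvPolynomial σ k →ₐ[k] Ω := MvPolynomial.aeval y
  have hf : Algebra.adjoin k S = f.range := Algebra.adjoin_range_eq_range_aeval k y
  rw [hf]
  have := lift_trdeg_le_of_surjective f.rangeRestrict f.rangeRestrict_surjective
  simpa using this

theorem Algebra.trdeg_le_of_isAlgebraic_range {F A Ω : Type u} [Field F] [CommRing A] [Field Ω]
    [Algebra F A] [Algebra F Ω] (f : A →ₐ[F] Ω) [Algebra.IsAlgebraic f.range Ω] :
    Algebra.trdeg F Ω ≤ Algebra.trdeg F A := by
  have h := trdeg_add_eq F f.range (A := Ω)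
  rw [trdeg_eq_zero (R := f.range), add_zero] at h
  rw [← h]
  exact trdeg_le_of_surjective f.rangeRestrict f.rangeRestrict_surjective

theorem FractionRing.isAlgebraic_of_isAlgebraic_X {k : Type*} [Field k] {σ : Type*}
    (S : Subalgebra k (FractionRing (MvPolynomial σ k)))
    (h : ∀ i, IsAlgebraic S
      (algebraMap (MvPolynomial σ k) (FractionRing (MvPolynomial σ k)) (.X i))) :
    Algebra.IsAlgebraic S (FractionRing (MvPolynomial σ k)) := by
  have h1 (p) : IsAlgebraic S
      (algebraMap (MvPolynomial σ k) (FractionRing (MvPolynomial σ k)) p) := by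
    induction p using MvPolynomial.induction_on with
    | C a =>
      have := isAlgebraic_algebraMap (A := FractionRing (MvPolynomial σ k)) (algebraMap k S a)
      rw [← IsScalarTower.algebraMap_apply] at this
      rwa [← MvPolynomial.algebraMap_eq, ← IsScalarTower.algebraMap_apply]
    | add p q hp hq => rw [map_add]; exact hp.add hq
    | mul_X p i hp => rw [map_mul]; exact hp.mul (h i)
  constructor
  intro x
  obtain ⟨a, b, hb, rfl⟩ := IsFractionRing.div_surjective (A := MvPolynomial σ k) x
  rw [div_eq_mul_inv]
  exact (h1 a).mul (h1 b).inv

/-- If `Ω` is algebraic over the `F`-algebra generated by the points `z i`, then some prime of height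
at most `card ι * q - trdeg F Ω` contains, for every `i`, the homogeneous relations over `F` among
the coordinates of `z i`. -/
theorem exists_prime_of_adjoin {F Ω : Type u} [Field F] [Field Ω] [Algebra F Ω]
    {ι : Type} [Fintype ι] [DecidableEq ι] (i₀ : ι) {q D : ℕ} (z : ι → Fin q → Ω)
    (hD : Algebra.trdeg F Ω = D)
    (halg : ∀ S : Subalgebra F Ω, (∀ i a, z i a ∈ S) → Algebra.IsAlgebraic S Ω) :
    ∃ p : Ideal (MvPolynomial (Fin q) F), p.IsPrime ∧ p.height + D ≤ (Fintype.card ι * q : ℕ) ∧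
      ∀ i, RingHom.ker (MvPolynomial.aeval (R := F)
        (fun a => Polynomial.C (z i a) * Polynomial.X : Fin q → Polynomial Ω)) ≤ p := by
  let ξ : ι × Fin q → Polynomial Ω := fun x => Polynomial.C (z x.1 x.2) * Polynomial.X
  let A : Subalgebra F (Polynomial Ω) := Algebra.adjoin F (Set.range ξ)
  have hξ (x) : ξ x ∈ A := Algebra.subset_adjoin ⟨x, rfl⟩
  have : Algebra.FiniteType F A := A.fg_iff_finiteType.1 ⟨(Set.finite_range ξ).toFinset, by simp [A]⟩
  have : IsNoetherianRing A := Algebra.FiniteType.isNoetherianRing F A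
  let f₁ : A →ₐ[F] Ω := ((Polynomial.aeval (1 : Ω)).restrictScalars F).comp A.val
  have := halg f₁.range fun i a => ⟨⟨ξ (i, a), hξ _⟩, by simp [f₁, ξ]⟩
  have hDA : (D : Cardinal) ≤ Algebra.trdeg F A := hD ▸ Algebra.trdeg_le_of_isAlgebraic_range f₁
  let f₀' : A →ₐ[F] Ω := ((Polynomial.aeval (0 : Ω)).restrictScalars F).comp A.val
  have hbot (x : A) : f₀' x ∈ (⊥ : Subalgebra F Ω) := by
    suffices A ≤ (⊥ : Subalgebra F Ω).comap ((Polynomial.aeval (0 : Ω)).restrictScalars F) from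
      this x.2
    refine Algebra.adjoin_le ?_
    rintro _ ⟨x, rfl⟩
    simp [ξ]
  let f₀ : A →ₐ[F] F := (Algebra.botEquiv F Ω : _ →ₐ[F] F).comp (f₀'.codRestrict _ hbot)
  have hf₀ (x : A) (hx : Polynomial.eval 0 (x : Polynomial Ω) = 0) : f₀ x = 0 := by
    have : f₀'.codRestrict _ hbot x = 0 := Subtype.ext (by simpa [f₀'] using hx)
    simp only [f₀, AlgHom.comp_apply, this, map_zero]
  let P : Ideal A := RingHom.ker f₀
  have hP : P.IsMaximal := RingHom.ker_isMaximal_of_surjective _ fun c =>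
    ⟨algebraMap F A c, by simp⟩
  obtain ⟨s, hs, hsP⟩ := Ideal.trdeg_le_height_of_isMaximal F P
  have hDP : (D : ℕ∞) ≤ P.height := by
    rw [hs] at hDA
    exact le_trans (by exact_mod_cast hDA) hsP
  let x (i : ι) (a : Fin q) : A := ⟨ξ (i, a), hξ _⟩
  let T : Set A := Set.range fun y : {i : ι // i ≠ i₀} × Fin q => x y.1 y.2 - x i₀ y.2
  have hT : T ⊆ P := by
    rintro _ ⟨y, rfl⟩
    exact hf₀ _ (by simp [x, ξ])
  have hTc : T.encard ≤ ((Fintype.card ι - 1) * q : ℕ) := by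
    change (Set.range _).encard ≤ _
    rw [← Set.image_univ]
    refine (Set.encard_image_le _ _).trans ?_
    rw [Set.encard_univ, ENat.card_eq_coe_fintype_card]
    simp
  let π (i : ι) : MvPolynomial (Fin q) F →ₐ[F] A ⧸ Ideal.span T :=
    (Ideal.Quotient.mkₐ F _).comp (MvPolynomial.aeval (x i))
  have hπ (i) : π i = π i₀ := by
    by_cases hi : i = i₀
    · rw [hi]
    refine MvPolynomial.algHom_ext fun a => ?_
    simp only [π, AlgHom.comp_apply, MvPolynomial.aeval_X, Ideal.Quotient.mkₐ_eq_mk]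
    exact Ideal.Quotient.eq.2 (Ideal.subset_span ⟨(⟨i, hi⟩, a), rfl⟩)
  have hsurj : Function.Surjective (π i₀) := by
    have key (y : Polynomial Ω) (hy : y ∈ A) :
        Ideal.Quotient.mkₐ F (Ideal.span T) ⟨y, hy⟩ ∈ (π i₀).range := by
      induction hy using Algebra.adjoin_induction with
      | mem y hy =>
        obtain ⟨⟨i, a⟩, rfl⟩ := hy
        rw [← hπ i]
        exact ⟨.X a, by simp [π, x]⟩
      | algebraMap r => exact Subalgebra.algebraMap_mem _ r
      | add y z hy hz h1 h2 => exact add_mem h1 h2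
      | mul y z hy hz h1 h2 => exact mul_mem h1 h2
    intro y
    obtain ⟨y, rfl⟩ := Ideal.Quotient.mk_surjective y
    exact key y.1 y.2
  obtain ⟨p, hp, hker, hle⟩ := MvPolynomial.exists_prime_height_le_of_surjective P T hT hTc hDP
    (π i₀).toRingHom hsurj
  refine ⟨p, hp, hle.trans ?_, fun i r hr => hker ?_⟩
  · have : 0 < Fintype.card ι := Fintype.card_pos_iff.2 ⟨i₀⟩
    obtain ⟨c, hc⟩ := Nat.exists_eq_succ_of_ne_zero this.ne'
    rw [hc]
    norm_cast
    simp [Nat.succ_mul, add_comm]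
  · have h1 : MvPolynomial.aeval (x i) r = 0 := by
      refine Subtype.ext ?_
      have := MvPolynomial.comp_aeval_apply (φ := A.val) (f := x i) r
      exact this.trans hr
    change π i₀ r = 0
    rw [← hπ i]
    simp [π, h1]

section

open MvPolynomial

theorem FractionRing.trdeg_mvPolynomial (k : Type*) [Field k] (σ : Type) [Fintype σ] :
    Algebra.trdeg k (FractionRing (MvPolynomial σ k)) = Fintype.card σ := by
  have : Algebra.IsAlgebraic (MvPolynomial σ k) (FractionRing (MvPolynomial σ k)) :=
    IsLocalization.isAlgebraic _ (nonZeroDivisors (MvPolynomial σ k))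
  have h := trdeg_add_eq k (MvPolynomial σ k) (A := FractionRing (MvPolynomial σ k))
  rw [trdeg_eq_zero (R := MvPolynomial σ k), add_zero] at h
  rw [← h, MvPolynomial.trdeg_of_isDomain]
  simp

theorem MvPolynomial.exists_forall_sum_homogeneousComponent {k σ ι : Type*} [CommSemiring k]
    [Fintype ι] (a : ι → MvPolynomial σ k) :
    ∃ N, ∀ N' ≥ N, ∀ j, ∑ d ∈ Finset.range N', homogeneousComponent d (a j) = a j := by
  refine ⟨Finset.univ.sup (fun j => (a j).totalDegree) + 1, fun N' hN' j => ?_⟩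
  rw [← Finset.sum_subset (s₁ := Finset.range ((a j).totalDegree + 1)), sum_homogeneousComponent]
  · rw [Finset.range_subset_range]
    refine le_trans (Nat.add_le_add_right ?_ 1) hN'
    exact Finset.le_sup (f := fun j => (a j).totalDegree) (Finset.mem_univ j)
  · intro d _ hd
    exact homogeneousComponent_eq_zero _ _ (by rw [Finset.mem_range] at hd; lia)

theorem sum_generic_mul_rename {k : Type*} [CommRing k] {q e n : ℕ}
    (B : Matrix (Fin e) (Fin n) (MvPolynomial (Fin q) k)) (a : Fin n → MvPolynomial (Fin q) k) :
    ∑ j, (∑ l, X (Sum.inr l) * rename Sum.inl (B l j) : MvPolynomial (Fin q ⊕ Fin e) k) *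
      rename Sum.inl (a j) = ∑ l, X (Sum.inr l) * rename Sum.inl (B.mulVec a l) := by
  simp only [Finset.sum_mul, Matrix.mulVec, dotProduct, map_sum, map_mul, Finset.mul_sum, mul_assoc]
  rw [Finset.sum_comm]

theorem linearIndependent_generic {k : Type*} [CommRing k] {q e n : ℕ}
    (B : Matrix (Fin e) (Fin n) (MvPolynomial (Fin q) k))
    (hB : ∀ c : Fin n → k, B.mulVec (fun j => C (c j)) = 0 → c = 0) :
    LinearIndependent k fun j =>
      (∑ l, X (Sum.inr l) * rename Sum.inl (B l j) : MvPolynomial (Fin q ⊕ Fin e) k) := by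
  rw [Fintype.linearIndependent_iff]
  intro c hc
  refine congrFun (hB c ?_)
  ext1 l
  let φ : MvPolynomial (Fin q ⊕ Fin e) k →ₐ[k] MvPolynomial (Fin q) k :=
    aeval (Sum.elim X (Pi.single l 1))
  have hφ (p) : φ (rename Sum.inl p) = p := by
    simp only [φ, aeval_rename, Sum.elim_comp_inl, aeval_X_left_apply]
  have hX (l') : φ (X (Sum.inr l')) = (Pi.single l 1 : Fin e → MvPolynomial (Fin q) k) l' := by
    simp only [φ, aeval_X, Sum.elim_inr]
  clear_value φ
  have := congrArg φ hc
  rw [map_zero, map_sum] at this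
  simpa [hφ, hX, Pi.single_apply, Matrix.mulVec, dotProduct, smul_eq_C_mul, mul_comm] using this

theorem aeval_algebraMap_X_eq {k : Type*} [Field k] {q e : ℕ} {ι : Type*} {Ω : Type*} [Field Ω]
    [Algebra k Ω] [Algebra (MvPolynomial (ι × (Fin q ⊕ Fin e)) k) Ω]
    [IsScalarTower k (MvPolynomial (ι × (Fin q ⊕ Fin e)) k) Ω] (i : ι) (p : MvPolynomial (Fin q) k) :
    aeval (fun a => algebraMap (MvPolynomial (ι × (Fin q ⊕ Fin e)) k) Ω (X (i, Sum.inl a))) p =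
      algebraMap (MvPolynomial (ι × (Fin q ⊕ Fin e)) k) Ω (rename (Prod.mk i) (rename Sum.inl p)) := by
  rw [← IsScalarTower.coe_toAlgHom' k, ← MvPolynomial.comp_aeval_apply, rename_rename,
    rename_eq_aeval]
  rfl

theorem exists_prime_of_generic {k : Type u} [Field k] {q e n : ℕ} {ι : Type} [Fintype ι]
    [DecidableEq ι] (i₀ : ι) (hn : Fintype.card ι ≤ n)
    (B : Matrix (Fin e) (Fin n) (MvPolynomial (Fin q) k))
    (G : Matrix (Fin n) (Fin e) (MvPolynomial (Fin q) k)) {g : MvPolynomial (Fin q) k}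
    (hg : g ≠ 0) (hBG : B * G = g • 1)
    (hhom : ∀ a, B.mulVec a = 0 → ∀ d, B.mulVec (fun j => homogeneousComponent d (a j)) = 0)
    (hB : ∀ c : Fin n → k, B.mulVec (fun j => C (c j)) = 0 → c = 0) :
    ∃ (F : Type u) (_ : Field F) (_ : Algebra k F) (Y : Matrix ι (Fin n) F)
      (H : Matrix (Fin n) ι F) (p : Ideal (MvPolynomial (Fin q) F)), Y * H = 1 ∧ p.IsPrime ∧
        (∀ a, B.mulVec a = 0 → ∀ i,
          ∑ j, C (Y i j) * MvPolynomial.map (algebraMap k F) (a j) ∈ p) ∧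
        p.height + (Fintype.card ι * e : ℕ) ≤ (Fintype.card ι * n : ℕ) := by
  classical
  let τ := Fin q ⊕ Fin e
  let Ω := FractionRing (MvPolynomial (ι × τ) k)
  let φ : MvPolynomial (ι × τ) k →ₐ[k] Ω := IsScalarTower.toAlgHom k _ _
  have hφinj : Function.Injective φ := IsFractionRing.injective (MvPolynomial (ι × τ) k) Ω
  let h (j : Fin n) : MvPolynomial τ k := ∑ l, X (Sum.inr l) * rename Sum.inl (B l j)
  have hh : LinearIndependent k h := linearIndependent_generic B hB
  let y (x : ι × Fin n) : Ω := φ (rename (Prod.mk x.1) (h x.2))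
  let z (i : ι) (a : Fin q) : Ω := φ (X (i, Sum.inl a))
  let F : IntermediateField k Ω := IntermediateField.adjoin k (Set.range y)
  have hyF (x) : y x ∈ F := IntermediateField.subset_adjoin _ _ ⟨x, rfl⟩
  have hz (i) (p : MvPolynomial (Fin q) k) :
      aeval (z i) p = φ (rename (Prod.mk i) (rename Sum.inl p)) := aeval_algebraMap_X_eq i p
  have hsum (i) (a : Fin n → MvPolynomial (Fin q) k) :
      ∑ j, y (i, j) * aeval (z i) (a j) =
        ∑ l, φ (X (i, Sum.inr l)) * aeval (z i) (B.mulVec a l) := by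
    have := congrArg (fun p => φ (rename (Prod.mk i) p)) (sum_generic_mul_rename B a)
    simpa only [y, h, hz, map_sum, map_mul, rename_X] using this
  have hΩ : Algebra.trdeg k Ω = (Fintype.card ι * (q + e) : ℕ) := by
    rw [FractionRing.trdeg_mvPolynomial]
    simp [τ]
  have hadd := trdeg_add_eq k F (A := Ω)
  obtain ⟨D, hD⟩ : ∃ D : ℕ, Algebra.trdeg F Ω = D := by
    refine ⟨_, (Cardinal.cast_toNat_of_lt_aleph0 ?_).symm⟩
    refine lt_of_le_of_lt (self_le_add_left _ _) (hadd.trans hΩ ▸ Cardinal.natCast_lt_aleph0)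
  have hDle : Fintype.card ι * (q + e) ≤ Fintype.card ι * n + D := by
    have h1 := IntermediateField.trdeg_adjoin_range_le (k := k) y
    have : ((Fintype.card ι * (q + e) : ℕ) : Cardinal) ≤ (Fintype.card ι * n + D : ℕ) := by
      rw [← hΩ, ← hadd, hD, Nat.cast_add]
      gcongr
      simpa [F] using h1
    exact_mod_cast this
  have halg (S : Subalgebra F Ω) (hS : ∀ i a, z i a ∈ S) : Algebra.IsAlgebraic S Ω := by
    let S' : Subalgebra k Ω := S.restrictScalars k
    have hzS (i) (p : MvPolynomial (Fin q) k) : IsAlgebraic S' (aeval (z i) p) := by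
      have : aeval (z i) p ∈ S' := by
        have h := MvPolynomial.comp_aeval_apply (φ := S'.val) (f := fun a => ⟨z i a, hS i a⟩) p
        exact h ▸ Subtype.property _
      exact isAlgebraic_algebraMap (⟨_, this⟩ : S')
    refine FractionRing.isAlgebraic_of_isAlgebraic_X S' ?_
    rintro ⟨i, a | l⟩
    · exact isAlgebraic_algebraMap (⟨_, hS i a⟩ : S')
    · have h1 : ∑ j, y (i, j) * aeval (z i) (G j l) = φ (X (i, Sum.inr l)) * aeval (z i) g := by
        rw [hsum i (fun j => G j l)]
        have h2 : B.mulVec (fun j => G j l) = Pi.single l g := by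
          ext1 l'
          have := congrFun (congrFun hBG l') l
          simpa [Matrix.mul_apply, Matrix.mulVec, dotProduct, Matrix.one_apply,
            Pi.single_apply] using this
        rw [h2, Finset.sum_eq_single l]
        · simp
        · intro b _ hb
          simp [hb]
        · simp
      have h3 : aeval (z i) g ≠ 0 := by
        rw [hz, Ne, map_eq_zero_iff φ hφinj,
          map_eq_zero_iff _ (rename_injective _ (Prod.mk_right_injective i)),
          map_eq_zero_iff _ (rename_injective _ Sum.inl_injective)]
        exact hg
      have h4 := eq_div_of_mul_eq h3 h1.symm
      change IsAlgebraic S' (φ (X (i, Sum.inr l)))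
      rw [h4, div_eq_mul_inv]
      refine IsAlgebraic.mul
        (sum_mem (S := Subalgebra.algebraicClosure S' Ω) fun j _ => ?_) (hzS i g).inv
      refine IsAlgebraic.mul ?_ (hzS i _)
      exact isAlgebraic_algebraMap (⟨_, S.algebraMap_mem ⟨_, hyF (i, j)⟩⟩ : S')
  obtain ⟨p, hp, hpD, hker⟩ := exists_prime_of_adjoin (F := F) i₀ z hD halg
  let Y : Matrix ι (Fin n) F := Matrix.of fun i j => ⟨y (i, j), hyF _⟩
  obtain ⟨H, hH⟩ : ∃ H : Matrix (Fin n) ι F, Y * H = 1 := by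
    refine Matrix.exists_mul_eq_one_of_vecMul_injective Y fun α hα => ?_
    have := MvPolynomial.eq_zero_of_sum_mul_algebraMap_rename_eq_zero hn hh
      (Ω := Ω) (fun i => (α i : Ω)) fun j => ?_
    · ext i
      simpa using congrFun this i
    · have := congrArg (algebraMap F Ω) (congrFun hα j)
      simpa [Matrix.vecMul, dotProduct, Y, y, φ] using this
  refine ⟨F, inferInstance, inferInstance, Y, H, p, hH, hp, fun a ha i => ?_, ?_⟩
  · apply hker i
    rw [RingHom.mem_ker]
    obtain ⟨N, hN⟩ := MvPolynomial.exists_forall_sum_homogeneousComponent a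
    have h1 (j) : aeval (R := F) (fun b => Polynomial.C (z i b) * Polynomial.X)
        (C (Y i j) * MvPolynomial.map (algebraMap k F) (a j)) =
          ∑ d ∈ Finset.range N, Polynomial.C (y (i, j) *
            aeval (z i) (homogeneousComponent d (a j))) * Polynomial.X ^ d := by
      rw [map_mul, aeval_map_algebraMap, algHom_C]
      conv_lhs => rw [← hN N le_rfl j]
      rw [map_sum, Finset.mul_sum]
      refine Finset.sum_congr rfl fun d _ => ?_
      rw [(homogeneousComponent_isHomogeneous d (a j)).aeval_C_mul_X, map_mul, mul_assoc]
      rfl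
    simp only [map_sum, h1]
    rw [Finset.sum_comm]
    refine Finset.sum_eq_zero fun d _ => ?_
    rw [← Finset.sum_mul, ← map_sum, hsum i, hhom a ha d]
    simp
  · have h2 : Fintype.card ι * (q + e) = Fintype.card ι * q + Fintype.card ι * e := by ring
    have h3 : p.height ≠ ⊤ := fun h => by
      rw [h, top_add] at hpD
      exact ENat.natCast_ne_top _ (top_le_iff.1 hpD)
    obtain ⟨m, hm⟩ := ENat.ne_top_iff_exists.1 h3
    rw [← hm] at hpD ⊢
    norm_cast at hpD ⊢
    lia

theorem exists_ringHom_of_generic {k : Type u} [Field k] {q e n : ℕ} {ι : Type} [Fintype ι]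
    [DecidableEq ι] (i₀ : ι) (hn : Fintype.card ι ≤ n)
    (B : Matrix (Fin e) (Fin n) (MvPolynomial (Fin q) k))
    (G : Matrix (Fin n) (Fin e) (MvPolynomial (Fin q) k)) {g : MvPolynomial (Fin q) k}
    (hg : g ≠ 0) (hBG : B * G = g • 1)
    (hhom : ∀ a, B.mulVec a = 0 → ∀ d, B.mulVec (fun j => homogeneousComponent d (a j)) = 0)
    (hB : ∀ c : Fin n → k, B.mulVec (fun j => C (c j)) = 0 → c = 0) :
    ∃ (κ : Type u) (_ : Field κ) (f : MvPolynomial (Fin q) k →+* κ) (c : Matrix ι (Fin n) κ)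
      (H : Matrix (Fin n) ι κ), c * H = 1 ∧ (∀ a, B.mulVec a = 0 → c.mulVec (f ∘ a) = 0) ∧
        (RingHom.ker f).height + (Fintype.card ι * e : ℕ) ≤ (Fintype.card ι * n : ℕ) := by
  obtain ⟨F, _, _, Y, H, p, hH, hp, hpa, hle⟩ := exists_prime_of_generic i₀ hn B G hg hBG hhom hB
  obtain ⟨κ, _, ψ, hψ⟩ : ∃ (κ : Type u) (_ : Field κ) (ψ : MvPolynomial (Fin q) F →+* κ),
      RingHom.ker ψ = p :=
    ⟨p.ResidueField, inferInstance, algebraMap _ _, Ideal.ker_algebraMap_residueField p⟩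
  refine ⟨κ, inferInstance, ψ.comp (MvPolynomial.map (algebraMap k F)), Y.map (ψ.comp C),
    H.map (ψ.comp C), ?_, fun a ha => ?_, ?_⟩
  · rw [← Matrix.map_mul, hH, Matrix.map_one _ (map_zero _) (map_one _)]
  · ext1 i
    have := hpa a ha i
    rw [← hψ, RingHom.mem_ker, map_sum] at this
    simpa [Matrix.mulVec, dotProduct] using this
  · rw [← RingHom.comap_ker, hψ]
    exact (add_le_add_left (MvPolynomial.height_comap_map_le p) _).trans hle

theorem Module.exists_matrix_of_rank_localizedModule {R M : Type*} [CommRing R] [IsDomain R]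
    [AddCommGroup M] [Module R M]
    (htf : ∀ (p : R) (x : M), p ∈ nonZeroDivisors R → p • x = 0 → x = 0) {e n : ℕ}
    (hrank : Module.rank (FractionRing R) (LocalizedModule (nonZeroDivisors R) M) = e)
    (v : Fin n → M) (hv : Submodule.span R (Set.range v) = ⊤) :
    ∃ (B : Matrix (Fin e) (Fin n) R) (G : Matrix (Fin n) (Fin e) R) (g : R), g ≠ 0 ∧
      B * G = g • 1 ∧ ∀ a : Fin n → R, ∑ j, a j • v j = 0 ↔ B.mulVec a = 0 := by
  let K := FractionRing R
  let V := LocalizedModule (nonZeroDivisors R) M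
  let φ : M →ₗ[R] V := LocalizedModule.mkLinearMap (nonZeroDivisors R) M
  have hφ : ∀ x, φ x = 0 ↔ x = 0 := by
    intro x
    rw [IsLocalizedModule.eq_zero_iff (nonZeroDivisors R)]
    exact ⟨fun ⟨c, hc⟩ => htf c x c.2 hc, fun h => ⟨1, by simp [h]⟩⟩
  have hspan : Submodule.span K (Set.range fun j => φ (v j)) = ⊤ := by
    have := span_eq_top_of_isLocalizedModule K (nonZeroDivisors R) φ hv
    rwa [← Set.range_comp] at this
  have : Module.Finite K V := ⟨⟨(Set.finite_range fun j => φ (v j)).toFinset, by simpa using hspan⟩⟩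
  let b : Module.Basis (Fin e) K V :=
    Module.finBasisOfFinrankEq K V (Module.finrank_eq_of_rank_eq hrank)
  have hG (l) : ∃ c : Fin n → K, ∑ j, c j • φ (v j) = b l := by
    rw [← Submodule.mem_span_range_iff_exists_fun, hspan]
    trivial
  choose G₀ hG₀ using hG
  obtain ⟨s, hs⟩ := IsLocalization.exist_integer_multiples_of_finite (nonZeroDivisors R)
    (fun x : Fin e × Fin n => b.repr (φ (v x.2)) x.1)
  obtain ⟨u, hu⟩ := IsLocalization.exist_integer_multiples_of_finite (nonZeroDivisors R)
    (fun x : Fin e × Fin n => G₀ x.1 x.2)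
  choose B hB using hs
  choose G hG using hu
  have hinj : Function.Injective (algebraMap R K) := IsFractionRing.injective R K
  refine ⟨Matrix.of fun l j => B (l, j), Matrix.of fun j l => G (l, j), s * u,
    mul_ne_zero (nonZeroDivisors.ne_zero s.2) (nonZeroDivisors.ne_zero u.2), ?_, fun a => ?_⟩
  · ext l l'
    apply hinj
    have h1 := congrArg (fun x => b.repr x l) (hG₀ l')
    simp only [map_sum, map_smul, Finsupp.coe_finsetSum, Finset.sum_apply, Finsupp.smul_apply,
      smul_eq_mul, Module.Basis.repr_self] at h1
    rw [Matrix.smul_apply, smul_eq_mul]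
    simp only [Matrix.mul_apply, Matrix.of_apply, map_sum, map_mul, hB, hG, Algebra.smul_def]
    trans algebraMap R K s * algebraMap R K u * (Finsupp.single l' 1 l : K)
    · rw [← h1, Finset.mul_sum]
      exact Finset.sum_congr rfl fun j _ => by ring
    · by_cases h : l = l'
      · subst h
        simp
      · simp [h]
  · rw [← hφ, ← b.repr.map_eq_zero_iff, Finsupp.ext_iff, _root_.funext_iff]
    refine forall_congr' fun l => ?_
    have hs0 : algebraMap R K s ≠ 0 := by
      simp
    rw [Finsupp.zero_apply, Pi.zero_apply, ← map_eq_zero_iff _ hinj]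
    simp only [map_sum, map_smul, Matrix.mulVec, dotProduct, Matrix.of_apply, map_mul, hB,
      Finsupp.coe_finsetSum, Finset.sum_apply]
    rw [← mul_eq_zero_iff_left hs0, Finset.mul_sum]
    refine Eq.congr (Finset.sum_congr rfl fun j _ => ?_) rfl
    rw [← IsScalarTower.algebraMap_smul K (a j), map_smul]
    simp only [Finsupp.smul_apply, smul_eq_mul, Algebra.smul_def]
    ring

theorem sum_homogeneousComponent_smul_eq_zero {k σ M : Type*} [CommRing k] [AddCommGroup M]
    [Module (MvPolynomial σ k) M] (ℳ : ℕ → AddSubgroup M) [DirectSum.Decomposition ℳ]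
    (hsmul : ∀ (a b : ℕ) (p : MvPolynomial σ k) (x : M),
      p ∈ homogeneousSubmodule σ k a → x ∈ ℳ b → p • x ∈ ℳ (a + b))
    {ι : Type*} [Fintype ι] (v : ι → M) (d : ℕ) (hv : ∀ j, v j ∈ ℳ d)
    (a : ι → MvPolynomial σ k) (ha : ∑ j, a j • v j = 0) (m : ℕ) :
    ∑ j, homogeneousComponent m (a j) • v j = 0 := by
  let x (i : ℕ) : M := ∑ j, homogeneousComponent i (a j) • v j
  have hx (i) : x i ∈ ℳ (i + d) :=
    sum_mem fun j _ => hsmul i d _ _ (homogeneousComponent_mem i (a j)) (hv j)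
  obtain ⟨N, hN⟩ := MvPolynomial.exists_forall_sum_homogeneousComponent a
  have hsum : ∑ i ∈ Finset.range (max N (m + 1)), x i = 0 := by
    rw [← ha, Finset.sum_comm]
    refine Finset.sum_congr rfl fun j _ => ?_
    rw [← Finset.sum_smul, hN _ (le_max_left _ _) j]
  have h := congrArg (fun y => (DirectSum.decompose ℳ y (m + d) : M)) hsum
  simp only [DirectSum.decompose_sum, DirectSum.decompose_zero, DirectSum.zero_apply,
    DirectSum.sum_apply, AddSubgroup.val_finsetSum, ZeroMemClass.coe_zero] at h
  rw [Finset.sum_eq_single m] at h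
  · rwa [DirectSum.decompose_of_mem_same ℳ (hx m)] at h
  · intro i _ hi
    exact DirectSum.decompose_of_mem_ne ℳ (hx i) (by lia)
  · intro hm
    simp at hm


theorem Module.eq_zero_of_sum_C_smul_eq_zero {k σ M : Type*} [Field k] [AddCommGroup M]
    [Module (MvPolynomial σ k) M] {n : ℕ} (v : Fin n → M)
    (hv : Submodule.span (MvPolynomial σ k) (Set.range v) = ⊤)
    (hmin : ∀ m (v' : Fin m → M), Submodule.span (MvPolynomial σ k) (Set.range v') = ⊤ → n ≤ m)
    (c : Fin n → k) (hc : ∑ j, (C (c j) : MvPolynomial σ k) • v j = 0) : c = 0 := by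
  obtain _ | n := n
  · exact Subsingleton.elim _ _
  by_contra h
  obtain ⟨i, hi⟩ := Function.ne_iff.1 h
  refine absurd (hmin n (v ∘ i.succAbove) ?_) (by lia)
  rw [eq_top_iff, ← hv, Submodule.span_le]
  set N := Submodule.span (MvPolynomial σ k) (Set.range (v ∘ i.succAbove))
  have hmem (j) : v (i.succAbove j) ∈ N := Submodule.subset_span ⟨j, rfl⟩
  rintro _ ⟨j, rfl⟩
  induction j using i.succAboveCases with
  | p j => exact hmem j
  | x =>
    rw [Fin.sum_univ_succAbove _ i] at hc
    have h1 : (C (c i) : MvPolynomial σ k) • v i ∈ N := by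
      rw [eq_neg_of_add_eq_zero_left hc]
      exact neg_mem (sum_mem fun j _ => N.smul_mem _ (hmem j))
    have h2 := N.smul_mem (C (c i)⁻¹) h1
    rwa [smul_smul, ← C_mul, inv_mul_cancel₀ hi, C_1, one_smul] at h2

/-- If `a ↦ c a` kills all relations among the generators `v`, has a right inverse and has more
rows than `U` has generators, then the colon ideal dies under `f`. -/
theorem Submodule.colon_le_ker_of_mul_eq_one {R κ M : Type*} [CommRing R] [Field κ] [AddCommGroup M]
    [Module R M] {ι ν σ : Type*} [Fintype ι] [DecidableEq ι] [Fintype ν] [DecidableEq ν] [Fintype σ]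
    (f : R →+* κ) (c : Matrix ι ν κ) (H : Matrix ν ι κ) (hH : c * H = 1) (v : ν → M)
    (hv : Submodule.span R (Set.range v) = ⊤)
    (hc : ∀ a : ν → R, ∑ j, a j • v j = 0 → c.mulVec (f ∘ a) = 0)
    (w : σ → M) (hcard : Fintype.card σ < Fintype.card ι) :
    (Submodule.span R (Set.range w)).colon ⊤ ≤ RingHom.ker f := by
  intro x hx
  have hw (s) : ∃ a : ν → R, ∑ j, a j • v j = w s := by
    rw [← Submodule.mem_span_range_iff_exists_fun, hv]
    trivial
  choose W hW using hw
  have hu (j) : ∃ a : σ → R, ∑ s, a s • w s = x • v j := by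
    rw [← Submodule.mem_span_range_iff_exists_fun]
    exact Submodule.mem_colon.1 hx _ trivial
  choose u hu using hu
  obtain ⟨α, hα0, hα⟩ := Matrix.exists_ne_zero_mulVec_eq_zero
    (Matrix.of fun s i => c.mulVec (f ∘ W s) i) hcard
  have hα' (s) : α ⬝ᵥ c.mulVec (f ∘ W s) = 0 := by
    rw [dotProduct_comm]
    exact congrFun hα s
  have hαc (j) : f x * Matrix.vecMul α c j = 0 := by
    have h1 := hc (Pi.single j x - ∑ s, u j s • W s) (by
      simp only [Pi.sub_apply, sub_smul, Finset.sum_sub_distrib, Finset.sum_apply, Pi.smul_apply,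
        Finset.sum_smul, smul_eq_mul, mul_smul]
      rw [Finset.sum_comm]
      simp only [← Finset.smul_sum, hW, hu, Pi.single_apply, ite_smul, zero_smul]
      simp)
    have h2 : f ∘ (Pi.single j x - ∑ s, u j s • W s) =
        Pi.single j (f x) - ∑ s, f (u j s) • (f ∘ W s) := by
      ext l
      by_cases h : l = j
      · subst h
        simp
      · simp [h]
    rw [h2, Matrix.mulVec_sub, Matrix.mulVec_sum] at h1
    have h3 := congrArg (fun y => α ⬝ᵥ y) h1
    simp only [dotProduct_sub, dotProduct_sum, Matrix.mulVec_smul, dotProduct_smul, hα', smul_zero,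
      Finset.sum_const_zero, sub_zero, dotProduct_zero] at h3
    rw [Matrix.dotProduct_mulVec, dotProduct_single, mul_comm] at h3
    exact h3
  by_contra hfx
  refine hα0 ?_
  have h4 : Matrix.vecMul α c = 0 := by
    ext j
    exact (mul_eq_zero.1 (hαc j)).resolve_left hfx
  rw [← Matrix.vecMul_one α, ← hH, ← Matrix.vecMul_vecMul, h4, Matrix.zero_vecMul]

end

/-- **Corollary 2.8 (second part).**  Let `R` be a polynomial ring over a field, `M` a
torsionfree graded `R`-module of rank `e` minimally generated by `n` homogeneous elements of
the same degree, and `r = n - e`.  Then for every submodule `U ⊆ M` generated by `t < n`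
elements, `ht (U :_R M) ≤ (t + 1) * r`. -/
theorem height_colon_le_of_graded {k : Type*} [Field k] {q : ℕ}
    {M : Type*} [AddCommGroup M] [Module (MvPolynomial (Fin q) k) M]
    (ℳ : ℕ → AddSubgroup M) [DirectSum.Decomposition ℳ]
    (hsmul : ∀ (a b : ℕ) (p : MvPolynomial (Fin q) k) (x : M),
      p ∈ MvPolynomial.homogeneousSubmodule (Fin q) k a → x ∈ ℳ b → p • x ∈ ℳ (a + b))
    (htf : ∀ (p : MvPolynomial (Fin q) k) (x : M),
      p ∈ nonZeroDivisors (MvPolynomial (Fin q) k) → p • x = 0 → x = 0)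
    {e n : ℕ}
    (hrank : Module.rank (FractionRing (MvPolynomial (Fin q) k))
      (LocalizedModule (nonZeroDivisors (MvPolynomial (Fin q) k)) M) = e)
    (v : Fin n → M) (d : ℕ) (hvhom : ∀ j, v j ∈ ℳ d)
    (hvgen : Submodule.span (MvPolynomial (Fin q) k) (Set.range v) = ⊤)
    (hmin : Module.mu (MvPolynomial (Fin q) k) M = n)
    (U : Submodule (MvPolynomial (Fin q) k) M) {t : ℕ} (htn : t < n)
    (w : Fin t → M) (hw : Submodule.span (MvPolynomial (Fin q) k) (Set.range w) = U) :
    (U.colon ⊤).ht ≤ ((t + 1) * (n - e) : ℕ) := by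
  obtain ⟨B, G, g, hg, hBG, hrel⟩ :=
    Module.exists_matrix_of_rank_localizedModule htf hrank v hvgen
  have hB (c : Fin n → k) (hc : B.mulVec (fun j => MvPolynomial.C (c j)) = 0) : c = 0 :=
    Module.eq_zero_of_sum_C_smul_eq_zero v hvgen
      (fun m v' hv' => hmin ▸ Nat.sInf_le ⟨v', hv'⟩) c ((hrel _).2 hc)
  have hhom (a : Fin n → MvPolynomial (Fin q) k) (ha : B.mulVec a = 0) (i : ℕ) :
      B.mulVec (fun j => MvPolynomial.homogeneousComponent i (a j)) = 0 :=
    (hrel _).1 (sum_homogeneousComponent_smul_eq_zero ℳ hsmul v d hvhom a ((hrel a).2 ha) i)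
  obtain ⟨κ, _, f, c, H, hH, hc, hht⟩ := exists_ringHom_of_generic (0 : Fin (t + 1))
    (by simpa using htn) B G hg hBG hhom hB
  have hle : U.colon ⊤ ≤ RingHom.ker f := hw ▸ Submodule.colon_le_ker_of_mul_eq_one f c H hH v
    hvgen (fun a ha => hc a ((hrel a).1 ha)) w (by simp)
  let P : PrimeSpectrum (MvPolynomial (Fin q) k) := ⟨RingHom.ker f, RingHom.ker_isPrime f⟩
  refine (iInf₂_le P hle).trans ?_
  rw [← PrimeSpectrum.height_eq_orderHeight]
  change (RingHom.ker f).height ≤ _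
  have hfin : (RingHom.ker f).height ≠ ⊤ := fun h => by
    rw [h, top_add] at hht
    exact ENat.natCast_ne_top _ (top_le_iff.1 hht)
  obtain ⟨m, hm⟩ := ENat.ne_top_iff_exists.1 hfin
  rw [← hm, Fintype.card_fin] at hht
  rw [← hm]
  norm_cast at hht ⊢
  rw [Nat.mul_sub]
  lia

end
end

section
/- Let (R, m) be a regular local ring and let φ be a symmetric n × n matrix of rank r all of whose entries lie in m. Then ht(I_1(φ)) ≤ r·n − binom(r, 2), i.e., the height of the ideal generated by the entries of φ is at most rn − r(r−1)/2. -/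
open IsLocalRing

noncomputable section

open Finset in
/-- If all elementary symmetric functions of positive degree at most `m` vanish at a vector with at
most `m` nonzero entries, then the vector is zero. -/
theorem eq_zero_of_card_support_le_of_esymm_eq_zero {ι S : Type*} [Fintype ι] [CommRing S]
    [IsDomain S] (v : ι → S) {m : ℕ} (hm : ∀ s : Finset ι, (∀ i ∈ s, v i ≠ 0) → #s ≤ m)
    (he : ∀ j, 1 ≤ j → j ≤ m → ∑ t ∈ powersetCard j univ, ∏ i ∈ t, v i = 0) : v = 0 := by
  classical
  set s : Finset ι := {i | v i ≠ 0} with hs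
  have hsm : #s ≤ m := hm s (by simp [hs])
  have hsum : ∑ t ∈ powersetCard #s univ, ∏ i ∈ t, v i = ∏ i ∈ s, v i := by
    refine sum_eq_single_of_mem s (by simp) fun t ht hts ↦ ?_
    by_contra hne
    refine hts (eq_of_subset_of_card_le (fun i hi ↦ ?_) (mem_powersetCard.1 ht).2.ge)
    simpa [hs] using fun h ↦ hne (prod_eq_zero hi h)
  have hne : ∏ i ∈ s, v i ≠ 0 := prod_ne_zero_iff.2 fun i hi ↦ by simpa [hs] using hi
  have h0 : #s = 0 := by
    by_contra h
    exact hne (hsum ▸ he _ (Nat.one_le_iff_ne_zero.2 h) hsm)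
  ext i
  by_contra h
  exact notMem_empty i (card_eq_zero.1 h0 ▸ by simpa [hs] using h)

namespace Matrix

variable {R S : Type*} [CommRing R] [CommRing S] {n : ℕ}

/-- The `k`-th superdiagonal of a square matrix, padded by zeros. -/
def superdiag (φ : Matrix (Fin n) (Fin n) R) (k : ℕ) (i : Fin n) : R :=
  if h : (i : ℕ) + k < n then φ i ⟨i + k, h⟩ else 0

/-- The `j`-th elementary symmetric function of the `k`-th superdiagonal. -/
def superdiagEsymm (φ : Matrix (Fin n) (Fin n) R) (k j : ℕ) : R :=
  ∑ t ∈ Finset.powersetCard j Finset.univ, ∏ i ∈ t, φ.superdiag k i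

theorem superdiag_map (φ : Matrix (Fin n) (Fin n) R) (f : R →+* S) (k : ℕ) (i : Fin n) :
    (φ.map f).superdiag k i = f (φ.superdiag k i) := by
  unfold superdiag
  split_ifs <;> simp

theorem superdiagEsymm_map (φ : Matrix (Fin n) (Fin n) R) (f : R →+* S) (k j : ℕ) :
    (φ.map f).superdiagEsymm k j = f (φ.superdiagEsymm k j) := by
  simp [superdiagEsymm, superdiag_map]

theorem superdiagEsymm_mem {φ : Matrix (Fin n) (Fin n) R} {I : Ideal R} (h : ∀ i j, φ i j ∈ I)
    (k : ℕ) {j : ℕ} (hj : 1 ≤ j) : φ.superdiagEsymm k j ∈ I := by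
  refine I.sum_mem fun t ht ↦ ?_
  obtain ⟨i, hi⟩ := Finset.card_pos.1 ((Finset.mem_powersetCard.1 ht).2 ▸ hj)
  refine I.mem_of_dvd (Finset.dvd_prod_of_mem _ hi) ?_
  unfold superdiag
  split_ifs
  exacts [h _ _, I.zero_mem]

/-- If all minors of size `r + 1` vanish and everything above the `k`-th superdiagonal is zero,
then the `k`-th superdiagonal has at most `r` nonzero entries. -/
theorem card_le_of_superdiag_ne_zero [IsDomain S] {ψ : Matrix (Fin n) (Fin n) S} {r k : ℕ}
    (hminor : ∀ f g : Fin (r + 1) → Fin n, (ψ.submatrix f g).det = 0)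
    (hk : ∀ i j : Fin n, (i : ℕ) + k < j → ψ i j = 0) {s : Finset (Fin n)}
    (hs : ∀ i ∈ s, ψ.superdiag k i ≠ 0) : s.card ≤ r := by
  by_contra! hlt
  obtain ⟨u, hus, hu⟩ := Finset.exists_subset_card_eq (Nat.succ_le_of_lt hlt)
  have hlt' (a : Fin (r + 1)) : (u.orderEmbOfFin hu a : ℕ) + k < n := by
    by_contra h
    exact hs _ (hus (u.orderEmbOfFin_mem hu a)) (by simp [superdiag, h])
  let g : Fin (r + 1) → Fin n := fun a ↦ ⟨u.orderEmbOfFin hu a + k, hlt' a⟩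
  have htri : (ψ.submatrix (u.orderEmbOfFin hu) g).IsLowerTriangular := by
    intro a b hab
    have hab' : u.orderEmbOfFin hu a < u.orderEmbOfFin hu b :=
      (u.orderEmbOfFin hu).lt_iff_lt.2 (by simpa using hab)
    exact hk _ _ (Nat.add_lt_add_right hab' k)
  have hdet := hminor (u.orderEmbOfFin hu) g
  rw [det_of_isLowerTriangular _ htri, Finset.prod_eq_zero_iff] at hdet
  obtain ⟨a, -, ha⟩ := hdet
  exact hs _ (hus (u.orderEmbOfFin_mem hu a)) (by simpa [superdiag, hlt' a] using ha)

theorem card_le_sub_of_superdiag_ne_zero {ψ : Matrix (Fin n) (Fin n) S} {k : ℕ}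
    {s : Finset (Fin n)} (hs : ∀ i ∈ s, ψ.superdiag k i ≠ 0) : s.card ≤ n - k := by
  rw [← Finset.card_range (n - k)]
  refine Finset.card_le_card_of_injOn Fin.val (fun i hi ↦ ?_) Fin.val_injective.injOn
  have : (i : ℕ) + k < n := by
    by_contra h
    exact hs i hi (by simp [superdiag, h])
  simp only [Finset.coe_range, Set.mem_Iio]
  omega

/-- A symmetric matrix over a domain whose minors of size `r + 1` vanish is zero as soon as
the elementary symmetric functions of degree at most `r` of its superdiagonals are. -/
theorem eq_zero_of_superdiagEsymm_eq_zero [IsDomain S] {ψ : Matrix (Fin n) (Fin n) S}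
    (hsym : ψ.IsSymm) {r : ℕ}
    (hminor : ∀ f g : Fin (r + 1) → Fin n, (ψ.submatrix f g).det = 0)
    (he : ∀ k j, k < n → 1 ≤ j → j ≤ min r (n - k) → ψ.superdiagEsymm k j = 0) : ψ = 0 := by
  have key (m : ℕ) : ∀ i j : Fin n, n ≤ (j : ℕ) - i + m → (i : ℕ) ≤ j → ψ i j = 0 := by
    induction m with
    | zero => intro i j h _; omega
    | succ m ih =>
      intro i j h hij
      set k := (j : ℕ) - i with hkdef
      have hk (i' j' : Fin n) (h' : (i' : ℕ) + k < j') : ψ i' j' = 0 :=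
        ih i' j' (by omega) (by omega)
      have hzero : ψ.superdiag k = 0 :=
        eq_zero_of_card_support_le_of_esymm_eq_zero _
          (fun s hs ↦ le_min (card_le_of_superdiag_ne_zero hminor hk hs)
            (card_le_sub_of_superdiag_ne_zero hs))
          (fun l hl hl' ↦ he k l (by omega) hl hl')
      have hji : (i : ℕ) + k = j := by omega
      simpa [superdiag, hji] using congrFun hzero i
  ext i j
  rcases le_total (i : ℕ) j with h | h
  · exact key n i j (by omega) h
  · rw [← hsym.apply i j]
    exact key n j i (by omega) h

theorem minorsIdeal_eq_bot_of_lt {m i : ℕ} (φ : Matrix (Fin n) (Fin m) R) (h : n < i) :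
    φ.minorsIdeal i = ⊥ := by
  refine Ideal.span_eq_bot.2 ?_
  rintro _ ⟨f, g, rfl⟩
  obtain ⟨a, b, hab, hf⟩ := Fintype.exists_ne_map_eq_of_card_lt f (by simpa using h)
  exact det_zero_of_row_eq hab (by ext; simp [hf])

theorem minorsIdeal_one_le {m : ℕ} {φ : Matrix (Fin n) (Fin m) R} {I : Ideal R}
    (h : ∀ i j, φ i j ∈ I) : φ.minorsIdeal 1 ≤ I := by
  refine Ideal.span_le.2 ?_
  rintro _ ⟨f, g, rfl⟩
  simpa using h _ _

end Matrix

theorem sum_range_min_sub_add_choose {n r : ℕ} (h : r ≤ n) :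
    ∑ k ∈ Finset.range n, min r (n - k) + r.choose 2 = r * n := by
  induction n, h using Nat.le_induction with
  | base =>
    simp only [Nat.sub_le, inf_of_le_right]
    induction r with
    | zero => simp
    | succ r ih =>
      rw [Finset.sum_range_succ', Nat.choose_succ_succ' r 1]
      simp only [Nat.add_sub_add_right, Nat.choose_one_right]
      grind
  | succ n hn ih =>
    rw [Finset.sum_range_succ']
    simp only [Nat.add_sub_add_right, Nat.sub_zero, min_eq_left (Nat.le_succ_of_le hn)]
    grind

/-- **Proposition 5.1(1).**  Let `(R, 𝔪)` be a regular local ring and `φ` a symmetric `n × n`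
matrix of rank `r` all of whose entries lie in `𝔪`.  Then
`ht I_1(φ) ≤ r * n - C(r, 2)`. -/
theorem height_minorsIdeal_one_le_of_symm {R : Type*} [CommRing R] [IsLocalRing R]
    (hreg : IsRegularLocal R) {n : ℕ} (φ : Matrix (Fin n) (Fin n) R)
    (hsym : φ.IsSymm) (hentries : ∀ i j, φ i j ∈ maximalIdeal R) {r : ℕ}
    (hr : φ.minorsIdeal r ≠ ⊥) (hr' : φ.minorsIdeal (r + 1) = ⊥) :
    (φ.minorsIdeal 1).ht ≤ (r * n - r.choose 2 : ℕ) := by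
  classical
  have := hreg.1
  have hrn : r ≤ n := by
    by_contra! h
    exact hr (φ.minorsIdeal_eq_bot_of_lt h)
  have hminor (f g : Fin (r + 1) → Fin n) : (φ.submatrix f g).det = 0 :=
    Ideal.span_eq_bot.1 hr' _ ⟨f, g, rfl⟩
  let G : Finset R := (Finset.range n).biUnion fun k ↦
    (Finset.Icc 1 (min r (n - k))).image (φ.superdiagEsymm k)
  have hGcard : G.card ≤ r * n - r.choose 2 := by
    rw [← sum_range_min_sub_add_choose hrn, Nat.add_sub_cancel]
    refine Finset.card_biUnion_le.trans (Finset.sum_le_sum fun k _ ↦ ?_)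
    simpa using Finset.card_image_le (s := Finset.Icc 1 (min r (n - k))) (f := φ.superdiagEsymm k)
  have hGle : Ideal.span (G : Set R) ≤ maximalIdeal R := by
    refine Ideal.span_le.2 fun x hx ↦ ?_
    simp only [G, Finset.coe_biUnion, Set.mem_iUnion, Finset.coe_image, Set.mem_image] at hx
    obtain ⟨k, -, j, hj, rfl⟩ := hx
    exact Matrix.superdiagEsymm_mem hentries k (Finset.mem_Icc.1 hj).1
  obtain ⟨P, hP, -⟩ := Ideal.exists_minimalPrimes_le hGle
  have hPprime : P.IsPrime := hP.1.1
  have hzero : φ.map (Ideal.Quotient.mk P) = 0 := by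
    refine Matrix.eq_zero_of_superdiagEsymm_eq_zero (hsym.map _) (r := r) (fun f g ↦ ?_)
      fun k j hk hj hj' ↦ ?_
    · rw [Matrix.submatrix_map, ← RingHom.mapMatrix_apply, ← RingHom.map_det, hminor, map_zero]
    · rw [Matrix.superdiagEsymm_map, Ideal.Quotient.eq_zero_iff_mem]
      exact hP.1.2 (Ideal.subset_span (Finset.mem_biUnion.2 ⟨k, Finset.mem_range.2 hk,
        Finset.mem_image_of_mem _ (Finset.mem_Icc.2 ⟨hj, hj'⟩)⟩))
  have hPle : φ.minorsIdeal 1 ≤ P := Matrix.minorsIdeal_one_le fun i j ↦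
    Ideal.Quotient.eq_zero_iff_mem.1 (congrFun₂ hzero i j)
  calc (φ.minorsIdeal 1).ht ≤ Order.height (⟨P, hPprime⟩ : PrimeSpectrum R) :=
        iInf₂_le (⟨P, hPprime⟩ : PrimeSpectrum R) hPle
    _ = P.height := (PrimeSpectrum.height_eq_orderHeight _).symm
    _ ≤ G.card := Ideal.height_le_card_of_mem_minimalPrimes_span_finset hP
    _ ≤ _ := by exact_mod_cast hGcard

end
end

section
/- Let k be a field, let i, r, m, n be integers with 1 ≤ i ≤ r ≤ n ≤ m, let R be the polynomial ring over k in the entries of a generic n × r matrix X and a generic r × m matrix Y, and let φ = X·Y. Then ht(I_i(φ)) = (r − i + 1)(n − i + 1) if m ≥ n + r − i + 1; ht(I_i(φ)) = (r − i + 1)(n − i + 1) − (r + n − m − i + 1)²/4 if r + n − m − i + 1 > 0 is even; and ht(I_i(φ)) = (r − i + 1)(n − i + 1) − ((r + n − m − i + 1)² − 1)/4 if r + n − m − i + 1 > 0 is odd. -/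
open IsLocalRing

noncomputable section

/-- The product of a generic `n × r` matrix and a generic `r × m` matrix, over the polynomial
ring in the entries of both. -/
def genericProduct (k : Type*) [Field k] (n r m : ℕ) :
    Matrix (Fin n) (Fin m) (MvPolynomial ((Fin n × Fin r) ⊕ (Fin r × Fin m)) k) :=
  (Matrix.of fun a b => MvPolynomial.X (Sum.inl (a, b))) *
    (Matrix.of fun a b => MvPolynomial.X (Sum.inr (a, b)))

section

open MvPolynomial

theorem MvPolynomial.height_fin_of_isMaximal {L : Type*} [Field L] (n : ℕ)
    (M : Ideal (MvPolynomial (Fin n) L)) [M.IsMaximal] : M.height = n := by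
  induction n with
  | zero =>
    have h : ringKrullDim (MvPolynomial (Fin 0) L) = 0 := by simp
    have := Ideal.height_le_ringKrullDim_of_ne_top (Ideal.IsMaximal.ne_top ‹M.IsMaximal›)
    rw [h] at this
    have h2 : M.height ≤ 0 := by exact_mod_cast this
    simpa using h2
  | succ n ih =>
    let e := (finSuccEquiv L n).toRingEquiv
    let P := M.comap e.symm
    have hP : P.IsMaximal := Ideal.comap_isMaximal_of_surjective _ e.symm.surjective
    have hp : (P.under (MvPolynomial (Fin n) L)).IsMaximal :=
      Polynomial.isMaximal_comap_C_of_isJacobsonRing P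
    have : P.LiesOver (P.under (MvPolynomial (Fin n) L)) := ⟨rfl⟩
    have h1 := Polynomial.height_eq_height_add_one (P.under (MvPolynomial (Fin n) L)) P
    rw [ih] at h1
    have h2 : P.height = M.height := RingEquiv.height_comap e.symm M
    rw [← h2, h1]; simp

theorem MvPolynomial.height_of_isMaximal {L σ : Type*} [Field L] [Finite σ]
    (M : Ideal (MvPolynomial σ L)) [M.IsMaximal] : M.height = Nat.card σ := by
  let e := (renameEquiv L (Finite.equivFin σ)).toRingEquiv
  have hP : (M.comap e.symm).IsMaximal :=
    Ideal.comap_isMaximal_of_surjective _ e.symm.surjective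
  rw [← MvPolynomial.height_fin_of_isMaximal _ (M.comap e.symm)]
  exact (RingEquiv.height_comap e.symm M).symm

theorem MvPolynomial.isMaximal_ker_aeval {L F σ : Type*} [Field L] [Field F] [Algebra L F]
    [Algebra.IsAlgebraic L F] (x : σ → F) :
    (RingHom.ker (aeval x : MvPolynomial σ L →ₐ[L] F)).IsMaximal := by
  apply Ideal.Quotient.maximal_of_isField
  have h := Subalgebra.isField_of_algebraic (aeval x : MvPolynomial σ L →ₐ[L] F).range
  exact (Ideal.quotientKerEquivRange (aeval x : MvPolynomial σ L →ₐ[L] F)).toMulEquiv.isField h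

open scoped IntermediateField.algebraAdjoinAdjoin in
attribute [local instance] algebraMvPolynomial in
theorem MvPolynomial.height_ker_aeval_sumElim {k F τ S : Type*} [Field k] [Field F] [Algebra k F]
    [Finite τ] (x : τ → F) (y : S → F) (hy : IsTranscendenceBasis k y) :
    (RingHom.ker (aeval (Sum.elim x y) : MvPolynomial (τ ⊕ S) k →ₐ[k] F)).height =
      Nat.card τ := by
  let A := Algebra.adjoin k (Set.range y)
  let L := IntermediateField.adjoin k (Set.range y)
  let e : MvPolynomial (τ ⊕ S) k ≃+* MvPolynomial τ A :=
    (sumAlgEquiv k τ S).toRingEquiv.trans (mapEquiv τ hy.1.aevalEquiv.toRingEquiv)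
  have := hy.isAlgebraic_field
  have hM := MvPolynomial.isMaximal_ker_aeval (L := L) x
  have h1 := MvPolynomial.height_of_isMaximal (RingHom.ker (aeval x : MvPolynomial τ L →ₐ[L] F))
  rw [← IsLocalization.height_under ((nonZeroDivisors A).map (C (σ := τ))),
    ← RingEquiv.height_comap e] at h1
  rw [← h1]
  congr 1
  have h2 : (aeval (Sum.elim x y) : MvPolynomial (τ ⊕ S) k →ₐ[k] F).toRingHom =
      ((aeval x : MvPolynomial τ L →ₐ[L] F).toRingHom.comp
        (map (algebraMap A L))).comp e.toRingHom := by
    have h3 (p) : ((algebraMap A L (hy.1.aevalEquiv p) : L) : F) = aeval y p :=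
      hy.1.algebraMap_aevalEquiv p
    ext i
    · simp [e, h3]
    · rcases i with i | i <;> simp [e, h3]
  exact congrArg RingHom.ker h2

theorem exists_index_set_isTranscendenceBasis {k F σ : Type*} [Field k] [Field F] [Algebra k F]
    (x : σ → F) [Algebra.IsAlgebraic (Algebra.adjoin k (Set.range x)) F] :
    ∃ s : Set σ, IsTranscendenceBasis k (fun i : s => x i) := by
  obtain ⟨t, ht, hb⟩ := exists_isTranscendenceBasis_subset (R := k) (Set.range x)
  choose g hg using fun i : t => ht i.2
  have hgi : Function.Injective g := fun a b hab => Subtype.ext (by rw [← hg a, ← hg b, hab])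
  refine ⟨Set.range g, ?_⟩
  rw [← isTranscendenceBasis_equiv (Equiv.ofInjective g hgi)]
  convert hb using 1
  ext i
  simp [hg]

open scoped IntermediateField.algebraAdjoinAdjoin in
theorem Algebra.IsAlgebraic.of_intermediateField_adjoin_eq_top {k F : Type*} [Field k] [Field F]
    [Algebra k F] {s : Set F} (hs : IntermediateField.adjoin k s = ⊤) :
    Algebra.IsAlgebraic (Algebra.adjoin k s) F := by
  have h1 : Algebra.IsAlgebraic (Algebra.adjoin k s) (IntermediateField.adjoin k s) :=
    IsLocalization.isAlgebraic _ (nonZeroDivisors (Algebra.adjoin k s))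
  refine ⟨fun z => ?_⟩
  have hz : z ∈ IntermediateField.adjoin k s := by rw [hs]; trivial
  have h2 := h1.isAlgebraic ⟨z, hz⟩
  exact h2.algebraMap (A := F)

/-- The dimension formula for the kernel of evaluation at a point generating the field `F`. -/
theorem MvPolynomial.height_ker_aeval_add_trdeg {k F σ : Type*} [Field k] [Field F] [Algebra k F]
    [Finite σ] (x : σ → F) (hx : IntermediateField.adjoin k (Set.range x) = ⊤) :
    (RingHom.ker (aeval x : MvPolynomial σ k →ₐ[k] F)).height +
      ((Algebra.trdeg k F).toNat : ℕ∞) = Nat.card σ := by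
  have := Algebra.IsAlgebraic.of_intermediateField_adjoin_eq_top hx
  obtain ⟨s, hs⟩ := exists_index_set_isTranscendenceBasis (k := k) x
  classical
  have h1 := MvPolynomial.height_ker_aeval_sumElim (fun i : (sᶜ : Set σ) => x i) _ hs
  have h2 : (Algebra.trdeg k F).toNat = Nat.card s := by
    have := congrArg Cardinal.toNat hs.lift_cardinalMk_eq_trdeg
    simpa [Nat.card] using this.symm
  let e : (sᶜ : Set σ) ⊕ s ≃ σ := (Equiv.sumComm _ _).trans (Equiv.Set.sumCompl s)
  have h3 : Nat.card σ = Nat.card (sᶜ : Set σ) + Nat.card s := by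
    rw [← Nat.card_congr e, Nat.card_sum]
  rw [h2, h3, Nat.cast_add, ← h1, ← RingEquiv.height_comap (renameEquiv k e).toRingEquiv]
  congr 2
  have h4 : (aeval (Sum.elim (fun i : (sᶜ : Set σ) => x i) (fun i : s => x i)) :
      MvPolynomial _ k →ₐ[k] F) = (aeval x).comp (renameEquiv k e).toAlgHom := by
    ext i
    rcases i with i | i <;> simp [e]
  rw [h4]
  rfl

theorem trdeg_toNat_le_of_adjoin_eq_top {k F ι : Type*} [Field k] [Field F] [Algebra k F]
    [Finite ι] (y : ι → F) (hy : IntermediateField.adjoin k (Set.range y) = ⊤) :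
    (Algebra.trdeg k F).toNat ≤ Nat.card ι := by
  have := Algebra.IsAlgebraic.of_intermediateField_adjoin_eq_top hy
  have h := Algebra.IsAlgebraic.trdeg_le_cardinalMk k (Set.range y)
  have h2 := Cardinal.toNat_le_toNat h (Cardinal.lt_aleph0_of_finite _)
  exact h2.trans (Finite.card_range_le y)

theorem exists_linearIndependent_comp_fin {K V ι : Type*} [Field K] [AddCommGroup V] [Module K V]
    [Finite ι] (v : ι → V) {i : ℕ}
    (hi : i ≤ Module.finrank K (Submodule.span K (Set.range v))) :
    ∃ f : Fin i → ι, LinearIndependent K (v ∘ f) := by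
  obtain ⟨κ, a, ha, hs, hl⟩ := exists_linearIndependent' K v
  have : Finite κ := Finite.of_injective a ha
  have := Fintype.ofFinite κ
  rw [← hs, finrank_span_eq_card hl] at hi
  obtain ⟨e⟩ := Function.Embedding.nonempty_of_card_le (α := Fin i) (β := κ) (by simpa using hi)
  exact ⟨a ∘ e, hl.comp e e.injective⟩

theorem Matrix.exists_det_submatrix_ne_zero_of_le_rank {K m n : Type*} [Field K] [Fintype m]
    [Fintype n] (M : Matrix m n K) {i : ℕ} (hi : i ≤ M.rank) :
    ∃ (f : Fin i → m) (g : Fin i → n), (M.submatrix f g).det ≠ 0 := by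
  rw [M.rank_eq_finrank_span_cols] at hi
  obtain ⟨g, hg⟩ := exists_linearIndependent_comp_fin _ hi
  have h1 : (M.submatrix id g).rank = i := by
    rw [← rank_transpose, LinearIndependent.rank_matrix (M := (M.submatrix id g).transpose) hg,
      Fintype.card_fin]
  rw [rank_eq_finrank_span_row] at h1
  obtain ⟨f, hf⟩ := exists_linearIndependent_comp_fin _ h1.ge
  refine ⟨f, g, ?_⟩
  have h2 : IsUnit (M.submatrix f g) := linearIndependent_rows_iff_isUnit.1 hf
  exact ((Matrix.isUnit_iff_isUnit_det _).1 h2).ne_zero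

/-- Some columns of `M` form a basis of its column space, and every other column is a linear
combination of these. -/
theorem Matrix.exists_col_subset {K m n : Type*} [Field K] [Fintype n] (M : Matrix m n K) :
    ∃ (s : Finset n) (C : n → n → K), s.card = M.rank ∧
      LinearIndependent K (M.submatrix id ((↑) : s → n)).col ∧
      ∀ i, ∀ j ∉ s, M i j = ∑ l ∈ s, M i l * C l j := by
  classical
  obtain ⟨κ, a, ha, hs, hl⟩ := exists_linearIndependent' K M.col
  have : Finite κ := Finite.of_injective a ha
  have := Fintype.ofFinite κ
  have h : ∀ j, ∃ c : κ → K, ∑ l, c l • M.col (a l) = M.col j := fun j => by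
    rw [← Submodule.mem_span_range_iff_exists_fun]
    have := Submodule.subset_span (R := K) (Set.mem_range_self (f := M.col) j)
    rw [← hs] at this
    exact this
  choose c hc using h
  refine ⟨Finset.univ.image a, fun l j => ∑ x with a x = l, c j x, ?_, ?_, fun i j _ => ?_⟩
  · rw [Finset.card_image_of_injective _ ha, rank_eq_finrank_span_cols, ← hs,
      finrank_span_eq_card hl, Finset.card_univ]
  · let e : κ ≃ (Finset.univ.image a : Finset n) :=
      (Equiv.ofInjective a ha).trans (Equiv.setCongr (by simp))
    rw [← linearIndependent_equiv e]
    exact hl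
  · rw [Finset.sum_image (fun x _ y _ h => ha h)]
    refine (congrFun (hc j) i).symm.trans ?_
    rw [Finset.sum_apply]
    refine Finset.sum_congr rfl fun x _ => ?_
    have : Finset.univ.filter (fun y => a y = a x) = {x} := by
      ext y; simp [ha.eq_iff]
    change c j x * M i (a x) = M i (a x) * ∑ y with a y = a x, c j y
    rw [this, Finset.sum_singleton, mul_comm]

theorem Matrix.rank_mul_eq_right_of_linearIndependent_col {K l m n : Type*} [Field K] [Fintype m]
    [Fintype n] (A : Matrix l m K) (B : Matrix m n K) (hA : LinearIndependent K A.col) :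
    (A * B).rank = B.rank := by
  rw [Matrix.rank, Matrix.rank, Matrix.mulVecLin_mul, LinearMap.range_comp]
  have h : Function.Injective A.mulVecLin := Matrix.mulVec_injective_iff.2 hA
  exact (LinearEquiv.finrank_eq (Submodule.equivMapOfInjective _ h _)).symm

/-- If the entries of `X` and `Y` generate the field `F` and `X * Y` has rank at most `t`, then the
transcendence degree of `F` is bounded by the dimension of one of the strata given by
`a = rank X` and `b = rank (X * Y)`. -/
theorem Matrix.exists_trdeg_le {k F : Type*} [Field k] [Field F] [Algebra k F] {n r m t : ℕ}
    (X : Matrix (Fin n) (Fin r) F) (Y : Matrix (Fin r) (Fin m) F)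
    (hXY : (X * Y).rank ≤ t)
    (hgen : ∀ L : IntermediateField k F, (∀ i j, X i j ∈ L) → (∀ i j, Y i j ∈ L) → L = ⊤) :
    ∃ a b : ℕ, a ≤ r ∧ a ≤ n ∧ b ≤ a ∧ b ≤ t ∧ b ≤ m ∧
      (Algebra.trdeg k F).toNat ≤
        n * a + (a * (r - a) + ((r - a) * m + (a * b + b * (m - b)))) := by
  obtain ⟨s, C, hs, hli, hX⟩ := X.exists_col_subset
  let A : Matrix (Fin n) s F := X.submatrix id (↑)
  let Z : Matrix s (Fin m) F := .of fun l j => Y l j + ∑ q ∈ sᶜ, C l q * Y q j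
  have hAZ : X * Y = A * Z := by
    ext i j
    simp only [Matrix.mul_apply, A, Z, submatrix_apply, id, of_apply]
    rw [Finset.sum_coe_sort s (fun l => X i l * (Y l j + ∑ q ∈ sᶜ, C l q * Y q j)),
      ← Finset.sum_add_sum_compl s]
    simp_rw [mul_add, Finset.sum_add_distrib]
    congr 1
    simp_rw [Finset.mul_sum]
    rw [Finset.sum_comm]
    refine Finset.sum_congr rfl fun q hq => ?_
    rw [hX i q (by simpa using hq), Finset.sum_mul]
    exact Finset.sum_congr rfl fun l _ => by ring
  have hZ : (X * Y).rank = Z.rank := by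
    rw [hAZ, Matrix.rank_mul_eq_right_of_linearIndependent_col _ _ hli]
  obtain ⟨s', V, hs', -, hV⟩ := Z.exists_col_subset
  have hsr : s.card ≤ r := by simpa using s.card_le_univ
  have hsm : s'.card ≤ m := by simpa using s'.card_le_univ
  refine ⟨s.card, s'.card, hsr, hs ▸ rank_le_height X, ?_, ?_, hsm, ?_⟩
  · rw [hs']; simpa using Z.rank_le_card_height
  · rw [hs', ← hZ]; exact hXY
  let y : (Fin n × s) ⊕ (s × (sᶜ : Finset _)) ⊕ ((sᶜ : Finset _) × Fin m) ⊕ (s × s') ⊕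
      (s' × (s'ᶜ : Finset _)) → F :=
    Sum.elim (fun p => X p.1 p.2) <| Sum.elim (fun p => C p.1 p.2) <|
      Sum.elim (fun p => Y p.1 p.2) <| Sum.elim (fun p => Z p.1 p.2) (fun p => V p.1 p.2)
  have hy (i) : y i ∈ IntermediateField.adjoin k (Set.range y) :=
    IntermediateField.subset_adjoin _ _ ⟨i, rfl⟩
  set L := IntermediateField.adjoin k (Set.range y) with hL
  have hC : ∀ l ∈ s, ∀ q ∉ s, C l q ∈ L := fun l hl q hq =>
    hy (.inr <| .inl (⟨l, hl⟩, ⟨q, by simpa using hq⟩))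
  have hXs : ∀ i, ∀ l ∈ s, X i l ∈ L := fun i l hl => hy (.inl (i, ⟨l, hl⟩))
  have hYs : ∀ l ∉ s, ∀ j, Y l j ∈ L := fun l hl j =>
    hy (.inr <| .inr <| .inl (⟨l, by simpa using hl⟩, j))
  have hZs : ∀ l, ∀ j ∈ s', Z l j ∈ L := fun l j hj =>
    hy (.inr <| .inr <| .inr <| .inl (l, ⟨j, hj⟩))
  have hVs : ∀ j ∈ s', ∀ q ∉ s', V j q ∈ L := fun j hj q hq =>
    hy (.inr <| .inr <| .inr <| .inr (⟨j, hj⟩, ⟨q, by simpa using hq⟩))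
  have hZL : ∀ l j, Z l j ∈ L := fun l j => by
    by_cases hj : j ∈ s'
    · exact hZs l j hj
    · rw [hV l j hj]
      exact sum_mem fun q hq => mul_mem (hZs l q hq) (hVs q hq j hj)
  have htop : L = ⊤ := by
    refine hgen L (fun i j => ?_) fun l j => ?_
    · by_cases hj : j ∈ s
      · exact hXs i j hj
      · rw [hX i j hj]
        exact sum_mem fun q hq => mul_mem (hXs i q hq) (hC q hq j hj)
    · by_cases hl : l ∈ s
      · have : Y l j = Z ⟨l, hl⟩ j - ∑ q ∈ sᶜ, C l q * Y q j := by simp [Z]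
        rw [this]
        refine sub_mem (hZL _ _) (sum_mem fun q hq => ?_)
        have hq : q ∉ s := by simpa using hq
        exact mul_mem (hC l hl q hq) (hYs q hq j)
      · exact hYs l hl j
  have := trdeg_toNat_le_of_adjoin_eq_top y htop
  simpa [Nat.card_eq_fintype_card, Finset.card_compl] using this

theorem IntermediateField.matrix_mem_of_mul_mem {k F l m : Type*} [Field k] [Field F] [Algebra k F]
    [Fintype l] [DecidableEq l] (L : IntermediateField k F) (P : Matrix l l F) (Q : Matrix l m F)
    (hdet : P.det ≠ 0) (hP : ∀ i j, P i j ∈ L) (hPQ : ∀ i j, (P * Q) i j ∈ L) (i : l) (j : m) :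
    Q i j ∈ L := by
  let P' : Matrix l l L := .of fun i j => ⟨P i j, hP i j⟩
  have hP' : P = (algebraMap L F).mapMatrix P' := rfl
  have h1 : P.adjugate * (P * Q) = P.det • Q := by
    rw [← Matrix.mul_assoc, Matrix.adjugate_mul, Matrix.smul_mul, Matrix.one_mul]
  have h2 : Q i j = P.det⁻¹ * (P.adjugate * (P * Q)) i j := by
    rw [h1, Matrix.smul_apply, smul_eq_mul, inv_mul_cancel_left₀ hdet]
  rw [h2, Matrix.mul_apply]
  refine mul_mem (inv_mem ?_) (sum_mem fun q _ => mul_mem ?_ (hPQ q j))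
  · rw [hP', ← RingHom.map_det]
    exact (Matrix.det P').2
  · rw [hP', ← RingHom.map_adjugate]
    exact (Matrix.adjugate P' i q).2

theorem MvPolynomial.det_of_X_ne_zero {k ι l : Type*} [Field k] [Fintype l] [DecidableEq l]
    (F : Type*) [Field F] [Algebra (MvPolynomial ι k) F] [IsFractionRing (MvPolynomial ι k) F]
    (g : l → l → ι) (hg : Function.Injective fun p : l × l => g p.1 p.2) :
    (Matrix.of fun i j => algebraMap (MvPolynomial ι k) F (X (g i j))).det ≠ 0 := by
  let f : MvPolynomial (l × l) k →+* F := (algebraMap (MvPolynomial ι k) F).comp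
    (rename (fun p : l × l => g p.1 p.2)).toRingHom
  have hf : Function.Injective f :=
    (IsFractionRing.injective (MvPolynomial ι k) F).comp (rename_injective _ hg)
  have h : (Matrix.of fun i j => algebraMap (MvPolynomial ι k) F (X (g i j))) =
      f.mapMatrix (Matrix.mvPolynomialX l l k) := by
    ext i j
    simp [f, Matrix.mvPolynomialX]
  rw [h, ← RingHom.map_det, Ne, map_eq_zero_iff f hf]
  exact Matrix.det_mvPolynomialX_ne_zero l k

theorem MvPolynomial.intermediateField_eq_top {k ι F : Type*} [Field k] [Field F]
    [Algebra (MvPolynomial ι k) F] [IsFractionRing (MvPolynomial ι k) F] [Algebra k F]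
    [IsScalarTower k (MvPolynomial ι k) F]
    (L : IntermediateField k F) (hL : ∀ i, algebraMap (MvPolynomial ι k) F (X i) ∈ L) :
    L = ⊤ := by
  have h (p : MvPolynomial ι k) : algebraMap (MvPolynomial ι k) F p ∈ L := by
    induction p using MvPolynomial.induction_on with
    | C c =>
      rw [← MvPolynomial.algebraMap_eq, ← IsScalarTower.algebraMap_apply]
      exact L.algebraMap_mem c
    | add p q hp hq => rw [map_add]; exact add_mem hp hq
    | mul_X p i hp => rw [map_mul]; exact mul_mem hp (hL i)
  refine eq_top_iff.2 fun z _ => ?_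
  obtain ⟨p, q, -, rfl⟩ := IsFractionRing.div_surjective (A := MvPolynomial ι k) z
  exact div_mem (h p) (h q)

theorem MvPolynomial.trdeg_fractionRing_toNat (k ι : Type*) [Field k] [Finite ι] :
    (Algebra.trdeg k (FractionRing (MvPolynomial ι k))).toNat = Nat.card ι := by
  have : Algebra.IsAlgebraic (MvPolynomial ι k) (FractionRing (MvPolynomial ι k)) :=
    IsLocalization.isAlgebraic _ (nonZeroDivisors (MvPolynomial ι k))
  have h := (IsTranscendenceBasis.mvPolynomial ι k).algebraMap_comp
    (A := FractionRing (MvPolynomial ι k))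
  have := congrArg Cardinal.toNat h.lift_cardinalMk_eq_trdeg
  simpa [Nat.card] using this.symm

/-- The stratum of pairs with `rank X = a` and `rank (X * Y) = t` has a generic point whose residue
field is purely transcendental of the expected degree. -/
theorem Matrix.exists_trdeg_eq (k : Type*) [Field k] {n r m t a u v : ℕ} (hr : r = a + u)
    (hm : m = t + v) (hta : t ≤ a) (han : a ≤ n) :
    ∃ (ι : Type) (_ : Finite ι) (X : Matrix (Fin n) (Fin r) (FractionRing (MvPolynomial ι k)))
      (Y : Matrix (Fin r) (Fin m) (FractionRing (MvPolynomial ι k))),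
      Nat.card ι = n * a + (a * u + (u * m + (a * t + t * v))) ∧ (X * Y).rank ≤ t ∧
      ∀ L : IntermediateField k (FractionRing (MvPolynomial ι k)),
        (∀ i j, X i j ∈ L) → (∀ i j, Y i j ∈ L) → L = ⊤ := by
  let ι := (Fin n × Fin a) ⊕ (Fin a × Fin u) ⊕ (Fin u × Fin m) ⊕ (Fin a × Fin t) ⊕ (Fin t × Fin v)
  let F := FractionRing (MvPolynomial ι k)
  let x : ι → F := fun i => algebraMap (MvPolynomial ι k) F (X i)
  let A : Matrix (Fin n) (Fin a) F := .of fun i j => x (.inl (i, j))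
  let C : Matrix (Fin a) (Fin u) F := .of fun i j => x (.inr <| .inl (i, j))
  let Y₂ : Matrix (Fin u) (Fin m) F := .of fun i j => x (.inr <| .inr <| .inl (i, j))
  let W : Matrix (Fin a) (Fin t) F := .of fun i j => x (.inr <| .inr <| .inr <| .inl (i, j))
  let V : Matrix (Fin t) (Fin v) F := .of fun i j => x (.inr <| .inr <| .inr <| .inr (i, j))
  let e : Fin r ≃ Fin a ⊕ Fin u := (finCongr hr).trans finSumFinEquiv.symm
  let e' : Fin m ≃ Fin t ⊕ Fin v := (finCongr hm).trans finSumFinEquiv.symm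
  let Z : Matrix (Fin a) (Fin m) F := (fromCols W (W * V)).submatrix id e'
  let X' : Matrix (Fin n) (Fin r) F := (fromCols A (A * C)).submatrix id e
  let Y' : Matrix (Fin r) (Fin m) F := (fromRows (Z - C * Y₂) Y₂).submatrix e id
  have hXY : X' * Y' = (A * W) * (fromCols 1 V).submatrix id e' := by
    have hZ : Z = W * (fromCols 1 V).submatrix id e' := by
      have : fromCols W (W * V) = W * fromCols 1 V := by
        rw [mul_fromCols, Matrix.mul_one]
      simp only [Z, this]
      rfl
    simp only [X', Y', submatrix_mul_equiv, fromCols_mul_fromRows, submatrix_id_id]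
    rw [Matrix.mul_sub, Matrix.mul_assoc A C, sub_add_cancel, hZ, Matrix.mul_assoc]
  refine ⟨ι, inferInstance, X', Y', by simp [ι, Nat.card_eq_fintype_card], ?_, fun L hX hY => ?_⟩
  · rw [hXY]
    exact (rank_mul_le_right _ _).trans (rank_le_height _)
  have hA : ∀ i j, A i j ∈ L := fun i j => by simpa [X'] using hX i (e.symm (.inl j))
  have hAC : ∀ i j, (A * C) i j ∈ L := fun i j => by
    have := hX i (e.symm (.inr j))
    simp only [X', submatrix_apply, Equiv.apply_symm_apply, fromCols_apply_inr] at this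
    exact this
  have hC : ∀ i j, C i j ∈ L :=
    L.matrix_mem_of_mul_mem (A.submatrix (Fin.castLE han) id) C
      (MvPolynomial.det_of_X_ne_zero (k := k) (ι := ι) F
        (fun i j => (Sum.inl (Fin.castLE han i, j) : ι))
        fun p q h => by simpa [ι, Prod.ext_iff] using h)
      (fun i j => hA _ _) fun i j => hAC _ _
  have hY₂ : ∀ i j, Y₂ i j ∈ L := fun i j => by simpa [Y'] using hY (e.symm (.inr i)) j
  have hZ : ∀ i j, Z i j ∈ L := fun i j => by
    have h1 := hY (e.symm (.inl i)) j
    simp only [Y', submatrix_apply, Equiv.apply_symm_apply, fromRows_apply_inl, id,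
      sub_apply] at h1
    have h2 : (C * Y₂) i j ∈ L := by
      rw [mul_apply]
      exact sum_mem fun q _ => mul_mem (hC _ _) (hY₂ _ _)
    simpa using add_mem h1 h2
  have hW : ∀ i j, W i j ∈ L := fun i j => by simpa [Z] using hZ i (e'.symm (.inl j))
  have hWV : ∀ i j, (W * V) i j ∈ L := fun i j => by
    have := hZ i (e'.symm (.inr j))
    simp only [Z, submatrix_apply, Equiv.apply_symm_apply, fromCols_apply_inr] at this
    exact this
  have hV : ∀ i j, V i j ∈ L :=
    L.matrix_mem_of_mul_mem (W.submatrix (Fin.castLE hta) id) V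
      (MvPolynomial.det_of_X_ne_zero (k := k) (ι := ι) F
        (fun i j => (Sum.inr <| Sum.inr <| Sum.inr <| Sum.inl (Fin.castLE hta i, j) : ι))
        fun p q h => by simpa [ι, Prod.ext_iff] using h)
      (fun i j => hW _ _) fun i j => hWV _ _
  refine MvPolynomial.intermediateField_eq_top (ι := ι) L fun i => ?_
  rcases i with ⟨i, j⟩ | ⟨i, j⟩ | ⟨i, j⟩ | ⟨i, j⟩ | ⟨i, j⟩
  exacts [hA i j, hC i j, hY₂ i j, hW i j, hV i j]

/-- Every prime of a polynomial ring is the kernel of evaluation at a point that generates its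
residue field. -/
theorem MvPolynomial.exists_ker_aeval_eq {k σ : Type*} [Field k] (P : Ideal (MvPolynomial σ k))
    [P.IsPrime] :
    ∃ x : σ → FractionRing (MvPolynomial σ k ⧸ P),
      RingHom.ker (aeval x : MvPolynomial σ k →ₐ[k] FractionRing (MvPolynomial σ k ⧸ P)) = P ∧
      IntermediateField.adjoin k (Set.range x) = ⊤ := by
  let g : MvPolynomial σ k →ₐ[k] FractionRing (MvPolynomial σ k ⧸ P) :=
    (IsScalarTower.toAlgHom k (MvPolynomial σ k ⧸ P) _).comp (Ideal.Quotient.mkₐ k P)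
  have hg : aeval (fun i => g (X i)) = g := by
    ext i; simp
  refine ⟨fun i => g (X i), ?_, ?_⟩
  · rw [hg]
    ext p
    rw [RingHom.mem_ker]
    change algebraMap (MvPolynomial σ k ⧸ P) _ (Ideal.Quotient.mk P p) = 0 ↔ _
    rw [FaithfulSMul.algebraMap_eq_zero_iff, Ideal.Quotient.eq_zero_iff_mem]
  · have h (p) : g p ∈ IntermediateField.adjoin k (Set.range fun i => g (X i)) := by
      refine IntermediateField.algebra_adjoin_le_adjoin _ _
        ((Algebra.adjoin_range_eq_range_aeval k (fun i => g (X i))).ge ⟨p, ?_⟩)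
      exact congrArg (fun f => f p) hg
    refine eq_top_iff.2 fun z _ => ?_
    obtain ⟨p, q, -, rfl⟩ := IsFractionRing.div_surjective (A := MvPolynomial σ k ⧸ P) z
    obtain ⟨p, rfl⟩ := Ideal.Quotient.mk_surjective p
    obtain ⟨q, rfl⟩ := Ideal.Quotient.mk_surjective q
    exact div_mem (h p) (h q)

theorem Matrix.minorsIdeal_le_ker_iff {R K : Type*} [CommRing R] [Field K] {n m i : ℕ}
    (φ : Matrix (Fin n) (Fin m) R) (f : R →+* K) :
    φ.minorsIdeal i ≤ RingHom.ker f ↔ (φ.map f).rank < i := by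
  have h (a : Fin i → Fin n) (b : Fin i → Fin m) :
      f (φ.submatrix a b).det = ((φ.map f).submatrix a b).det := by
    rw [RingHom.map_det]; rfl
  refine ⟨fun hle => ?_, fun hlt => Ideal.span_le.2 ?_⟩
  · by_contra! hi
    obtain ⟨a, b, hab⟩ := Matrix.exists_det_submatrix_ne_zero_of_le_rank _ hi
    exact hab ((h a b).symm.trans (hle (Ideal.subset_span ⟨a, b, rfl⟩)))
  · rintro _ ⟨a, b, rfl⟩
    by_contra hne
    rw [SetLike.mem_coe, RingHom.mem_ker, h] at hne
    have h1 := Matrix.rank_of_det_ne_zero hne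
    have h2 := Matrix.rank_submatrix_le (φ.map f) a b
    rw [Fintype.card_fin] at h1
    omega

theorem genericProduct_map_aeval {k F : Type*} [Field k] [Field F] [Algebra k F] {n r m : ℕ}
    (x : (Fin n × Fin r) ⊕ (Fin r × Fin m) → F) :
    (genericProduct k n r m).map (aeval x : MvPolynomial _ k →ₐ[k] F).toRingHom =
      (Matrix.of fun a b => x (.inl (a, b))) * (Matrix.of fun a b => x (.inr (a, b))) := by
  ext a b
  have h : genericProduct k n r m a b = ∑ c, X (Sum.inl (a, c)) * X (Sum.inr (c, b)) := rfl
  simp [Matrix.mul_apply, h]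

theorem IntermediateField.adjoin_range_sum_eq_top_iff {k F : Type*} [Field k] [Field F]
    [Algebra k F] {n r m : ℕ} (x : (Fin n × Fin r) ⊕ (Fin r × Fin m) → F) :
    IntermediateField.adjoin k (Set.range x) = ⊤ ↔
      ∀ L : IntermediateField k F, (∀ i j, x (.inl (i, j)) ∈ L) →
        (∀ i j, x (.inr (i, j)) ∈ L) → L = ⊤ := by
  refine ⟨fun h L h1 h2 => eq_top_iff.2 (h ▸ IntermediateField.adjoin_le_iff.2 ?_), fun h =>
    h _ (fun i j => ?_) fun i j => ?_⟩
  · rintro _ ⟨⟨i, j⟩ | ⟨i, j⟩, rfl⟩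
    exacts [h1 i j, h2 i j]
  all_goals exact IntermediateField.subset_adjoin _ _ ⟨_, rfl⟩

/-- A lower bound for the height of the determinantal ideal, from a bound on the dimension of
every stratum. -/
theorem le_ht_minorsIdeal_genericProduct {k : Type*} [Field k] {n r m t h : ℕ}
    (hh : ∀ a b : ℕ, a ≤ r → a ≤ n → b ≤ a → b ≤ t → b ≤ m →
      h + (n * a + (a * (r - a) + ((r - a) * m + (a * b + b * (m - b))))) ≤ n * r + r * m) :
    (h : ℕ∞) ≤ ((genericProduct k n r m).minorsIdeal (t + 1)).ht := by
  refine le_iInf₂ fun P hP => ?_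
  obtain ⟨x, hx, htop⟩ := MvPolynomial.exists_ker_aeval_eq P.asIdeal
  have hrank : ((genericProduct k n r m).map (aeval x : MvPolynomial _ k →ₐ[k] _).toRingHom).rank
      < t + 1 := (Matrix.minorsIdeal_le_ker_iff _ _).1 (hP.trans hx.ge)
  rw [genericProduct_map_aeval] at hrank
  obtain ⟨a, b, h1, h2, h3, h4, h5, hD⟩ := Matrix.exists_trdeg_le _ _ (Nat.lt_succ_iff.1 hrank)
    ((IntermediateField.adjoin_range_sum_eq_top_iff x).1 htop)
  have hN := MvPolynomial.height_ker_aeval_add_trdeg x htop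
  rw [hx, PrimeSpectrum.height_eq_orderHeight] at hN
  have hcard : Nat.card ((Fin n × Fin r) ⊕ (Fin r × Fin m)) = n * r + r * m := by
    simp [Nat.card_eq_fintype_card]
  rw [hcard] at hN
  have := hh a b h1 h2 h3 h4 h5
  generalize Order.height P = H at hN ⊢
  induction H using ENat.recTopCoe with
  | top => exact le_top
  | coe H =>
    norm_cast at hN ⊢
    omega

/-- An upper bound for the height of the determinantal ideal, from the dimension of one stratum. -/
theorem ht_minorsIdeal_genericProduct_le {k : Type*} [Field k] {n r m t a u v h : ℕ}
    (hr : r = a + u) (hm : m = t + v) (hta : t ≤ a) (han : a ≤ n)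
    (hh : n * r + r * m ≤ h + (n * a + (a * u + (u * m + (a * t + t * v))))) :
    ((genericProduct k n r m).minorsIdeal (t + 1)).ht ≤ h := by
  obtain ⟨ι, hι, X, Y, hD, hrank, hgen⟩ := Matrix.exists_trdeg_eq k hr hm hta han
  let x : (Fin n × Fin r) ⊕ (Fin r × Fin m) → FractionRing (MvPolynomial ι k) :=
    Sum.elim (fun p => X p.1 p.2) (fun p => Y p.1 p.2)
  let P : PrimeSpectrum (MvPolynomial ((Fin n × Fin r) ⊕ (Fin r × Fin m)) k) :=
    ⟨RingHom.ker (aeval x : MvPolynomial _ k →ₐ[k] _).toRingHom, RingHom.ker_isPrime _⟩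
  have hP : (genericProduct k n r m).minorsIdeal (t + 1) ≤ P.asIdeal := by
    refine (Matrix.minorsIdeal_le_ker_iff _ _).2 ?_
    rw [genericProduct_map_aeval]
    exact Nat.lt_succ_iff.2 hrank
  refine (iInf₂_le P hP).trans ?_
  have hN := MvPolynomial.height_ker_aeval_add_trdeg x
    ((IntermediateField.adjoin_range_sum_eq_top_iff x).2 hgen)
  rw [MvPolynomial.trdeg_fractionRing_toNat, hD] at hN
  have hcard : Nat.card ((Fin n × Fin r) ⊕ (Fin r × Fin m)) = n * r + r * m := by
    simp [Nat.card_eq_fintype_card]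
  change P.asIdeal.height + _ = _ at hN
  rw [hcard, PrimeSpectrum.height_eq_orderHeight] at hN
  generalize Order.height P = H at hN ⊢
  induction H using ENat.recTopCoe with
  | top => simp at hN; exact absurd hN (by exact_mod_cast ENat.top_ne_natCast _)
  | coe H =>
    norm_cast at hN ⊢
    omega

theorem ht_minorsIdeal_genericProduct {k : Type*} [Field k] {t s p w v₀ h : ℕ}
    (hsp : s ≤ p) (hv₀ : v₀ ≤ s)
    (hmax : ∀ v : ℕ, v * ((p : ℤ) - w + s - v) ≤ v₀ * ((p : ℤ) - w + s - v₀))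
    (hh : (h : ℤ) = s * p - v₀ * ((p : ℤ) - w + s - v₀)) :
    ((genericProduct k (t + p) (t + s) (t + w)).minorsIdeal (t + 1)).ht = h := by
  refine le_antisymm ?_ (le_ht_minorsIdeal_genericProduct fun a b har han hba hbt hbm => ?_)
  · obtain ⟨u, rfl⟩ := Nat.exists_eq_add_of_le hv₀
    refine ht_minorsIdeal_genericProduct_le (a := t + v₀) (u := u) (v := w) (by ring) rfl
      (by omega) (by omega) ?_
    zify
    push_cast at hh ⊢
    rw [hh]
    apply le_of_eq
    ring
  · obtain ⟨u, hu⟩ := Nat.exists_eq_add_of_le har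
    obtain ⟨z, hz⟩ := Nat.exists_eq_add_of_le hbm
    rw [hu, hz, Nat.add_sub_cancel_left, Nat.add_sub_cancel_left, ← hu, ← hz]
    zify at *
    rw [hh]
    have hu' : (u : ℤ) = t + s - a := by omega
    have hz' : (z : ℤ) = t + w - b := by omega
    rw [hu', hz']
    rcases le_total a t with hat | hat
    · have h0 := hmax 0
      zify at hat
      have h1 : 0 ≤ ((t : ℤ) - a) * (t - a + p + s) := mul_nonneg (by omega) (by omega)
      have h2 : 0 ≤ ((a : ℤ) - b) * (t + w - b) := mul_nonneg (by omega) (by omega)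
      push_cast at h0
      linear_combination h0 + h1 + h2
    · obtain ⟨v, rfl⟩ := Nat.exists_eq_add_of_le hat
      have h0 := hmax v
      have h1 : 0 ≤ ((t : ℤ) - b) * (w + (t + v - b)) := mul_nonneg (by omega) (by omega)
      push_cast at h0 h1 ⊢
      linear_combination h0 + h1

end

/-- **Example 4.1.**  Let `1 ≤ i ≤ r ≤ n ≤ m` and let `φ` be the product of a generic `n × r`
matrix with a generic `r × m` matrix.  Writing `c = r + n - m - i + 1`, one has
`ht I_i(φ) = (r-i+1)(n-i+1)` if `m ≥ n + r - i + 1`, and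
`ht I_i(φ) = (r-i+1)(n-i+1) - c²/4` (resp. `(r-i+1)(n-i+1) - (c²-1)/4`) if `c > 0` is even
(resp. odd). -/
theorem height_minorsIdeal_genericProduct {k : Type*} [Field k] {i r m n : ℕ}
    (h1 : 1 ≤ i) (h2 : i ≤ r) (h3 : r ≤ n) (h4 : n ≤ m) :
    (n + r - i + 1 ≤ m →
      ((genericProduct k n r m).minorsIdeal i).ht = ((r - i + 1) * (n - i + 1) : ℕ)) ∧
    (∀ c : ℤ, c = (r : ℤ) + n - m - i + 1 → 0 < c →
      (Even c →
        ((genericProduct k n r m).minorsIdeal i).ht =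
          (((((r - i + 1) * (n - i + 1) : ℕ) : ℤ) - c ^ 2 / 4).toNat : ℕ∞)) ∧
      (Odd c →
        ((genericProduct k n r m).minorsIdeal i).ht =
          (((((r - i + 1) * (n - i + 1) : ℕ) : ℤ) - (c ^ 2 - 1) / 4).toNat : ℕ∞))) := by
  obtain ⟨t, rfl⟩ : ∃ t, i = t + 1 := ⟨i - 1, by omega⟩
  obtain ⟨s, rfl⟩ : ∃ s, r = t + s := ⟨r - t, by omega⟩
  obtain ⟨p, rfl⟩ : ∃ p, n = t + p := ⟨n - t, by omega⟩
  obtain ⟨w, rfl⟩ : ∃ w, m = t + w := ⟨m - t, by omega⟩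
  rw [show t + s - (t + 1) + 1 = s by omega, show t + p - (t + 1) + 1 = p by omega]
  refine ⟨fun hm => ?_, fun c hc hpos => ?_⟩
  · refine ht_minorsIdeal_genericProduct (s := s) (p := p) (w := w) (v₀ := 0) (by omega) (by omega)
      (fun v => ?_) (by simp)
    have h1 : (v : ℤ) * (p - w + s - v) ≤ 0 :=
      mul_nonpos_of_nonneg_of_nonpos (by omega) (by omega)
    simpa using h1
  have hc' : c = p - w + s := by
    push_cast at hc
    linear_combination hc
  have hsp : (s : ℤ) * c ≤ s * p := mul_le_mul_of_nonneg_left (by omega) (by omega)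
  refine ⟨fun ⟨d, hd⟩ => ?_, fun ⟨d, hd⟩ => ?_⟩
  · have hcd : c ^ 2 / 4 = d ^ 2 := by
      rw [hd, show (d + d) ^ 2 = 4 * d ^ 2 by ring]
      exact Int.mul_ediv_cancel_left _ (by norm_num)
    have hds : d * d ≤ s * c := by
      rw [hd]; exact mul_le_mul (by omega) (by omega) (by omega) (by omega)
    lift d to ℕ using by omega
    refine ht_minorsIdeal_genericProduct (s := s) (p := p) (w := w) (v₀ := d) (by omega) (by omega)
      (fun v => ?_) ?_
    · rw [← hc', hd]
      linear_combination sq_nonneg ((d : ℤ) - v)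
    · rw [← hc', hcd, Int.toNat_of_nonneg (by push_cast; linarith [sq (d : ℤ)]), hd]
      push_cast
      ring
  · have hcd : (c ^ 2 - 1) / 4 = d * (d + 1) := by
      rw [hd, show (2 * d + 1) ^ 2 - 1 = 4 * (d * (d + 1)) by ring]
      exact Int.mul_ediv_cancel_left _ (by norm_num)
    have hds : d * (d + 1) ≤ s * c := by
      rw [hd]; exact mul_le_mul (by omega) (by omega) (by omega) (by omega)
    lift d to ℕ using by omega
    refine ht_minorsIdeal_genericProduct (s := s) (p := p) (w := w) (v₀ := d) (by omega) (by omega)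
      (fun v => ?_) ?_
    · rw [← hc', hd]
      have h1 : 0 ≤ ((d : ℤ) - v) * (d - v + 1) := by
        rcases le_or_gt (v : ℤ) d with h | h
        · exact mul_nonneg (by omega) (by omega)
        · exact mul_nonneg_of_nonpos_of_nonpos (by omega) (by omega)
      linear_combination h1
    · rw [← hc', hcd, Int.toNat_of_nonneg (by push_cast; linarith), hd]
      push_cast
      ring

end
end
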